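/- arXiv:2508.04359 — 5 statements merged into one kernel-verified Lean document; each statement's English description precedes it below -/
import Mathlib

section
/- For every complex q with |q| < 1, the generating function of the number of non-Rascoe partitions satisfies ∑_{n=0}^{∞} b(n) q^n = (-q;q)_∞ · σ₂(q) = ∑_{n=0}^{∞} (-1)^n q^{n²} (-q^{n+1};q)_∞. -/
open scoped BigOperators

/-- The finite q-Pochhammer symbol `(a;q)_n`. -/
noncomputable def qPoch (a q : ℂ) (n : ℕ) : ℂ := ∏ k ∈ Finset.range n, (1 - a * q ^ k)

/-- The infinite q-Pochhammer symbol `(a;q)_∞`. -/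
noncomputable def qPochInf (a q : ℂ) : ℂ := ∏' k : ℕ, (1 - a * q ^ k)

/-- `b n` is the number of non-Rascoe partitions of `n`: partitions into distinct parts in
which the number of parts is not itself a part.  (For `n = 0` the empty partition counts,
so `b 0 = 1`.) -/
noncomputable def b (n : ℕ) : ℕ :=
  Nat.card {p : Nat.Partition n // p.parts.Nodup ∧ Multiset.card p.parts ∉ p.parts}

/-- The rank parity function `σ₂(q)` associated to Rogers–Ramanujan partitions. -/
noncomputable def sigma2 (q : ℂ) : ℂ := ∑' n : ℕ, (-1) ^ n * q ^ (n ^ 2) / qPoch (-q) q n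

open Finset

/-- The exponent of `q` contributed to `q ^ (n ^ 2) * (-q ^ (n + 1); q)_∞` by the partition into
the distinct parts `k + n + 1`, `k ∈ s`. -/
def shiftedExponent (n : ℕ) (s : Finset ℕ) : ℕ := n ^ 2 + ∑ k ∈ s, (k + (n + 1))

/-- The finsets `s` for which `#s + 2 * n` is not among the parts `k + n + 1`, `k ∈ s`. -/
def cardAvoiding (n : ℕ) : Set (Finset ℕ) := {s | ∀ k ∈ s, k + 1 ≠ #s + n}

lemma mem_cardAvoiding_succ {n : ℕ} {s : Finset ℕ} :
    s ∈ cardAvoiding (n + 1) ↔ #s + n ∉ s := by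
  constructor
  · intro h hs
    exact h _ hs (by omega)
  · intro h k hk hk'
    exact h ((show k = #s + n by omega) ▸ hk)

/-- Inserting the missing part `#s + n` maps `cardAvoiding (n + 1)` bijectively onto the complement
of `cardAvoiding n`. -/
noncomputable def insertCardEquiv (n : ℕ) :
    cardAvoiding (n + 1) ≃ ((cardAvoiding n)ᶜ : Set (Finset ℕ)) :=
  Equiv.ofBijective
    (fun s ↦ ⟨insert (#s.1 + n) s.1, fun h ↦ h _ (mem_insert_self _ _) (by
      rw [card_insert_of_notMem (mem_cardAvoiding_succ.1 s.2)]
      omega)⟩) <| by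
    constructor
    · rintro ⟨s, hs⟩ ⟨t, ht⟩ h
      rw [mem_cardAvoiding_succ] at hs ht
      have h' : insert (#s + n) s = insert (#t + n) t := congrArg Subtype.val h
      have hc := congrArg card h'
      rw [card_insert_of_notMem hs, card_insert_of_notMem ht, Nat.add_right_cancel_iff] at hc
      rw [hc] at h' hs
      rw [Subtype.mk.injEq, ← erase_insert hs, h', erase_insert ht]
    · rintro ⟨s, hs⟩
      obtain ⟨k, hk, hks⟩ : ∃ k ∈ s, k + 1 = #s + n := by
        simpa [cardAvoiding] using hs
      have hcard := card_erase_add_one hk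
      have hk' : #(s.erase k) + n = k := by omega
      refine ⟨⟨s.erase k, mem_cardAvoiding_succ.2 (by simp [hk'])⟩, Subtype.ext ?_⟩
      simp only [hk', insert_erase hk]

lemma shiftedExponent_insertCardEquiv (n : ℕ) (s : cardAvoiding (n + 1)) :
    shiftedExponent n (insertCardEquiv n s).1 = shiftedExponent (n + 1) s.1 := by
  have hs := mem_cardAvoiding_succ.1 s.2
  change shiftedExponent n (insert (#s.1 + n) s.1) = _
  simp only [shiftedExponent, sum_insert hs, sum_add_distrib, sum_const, smul_eq_mul]
  ring

section Analytic

variable {q : ℂ}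

lemma summable_norm_pow_add (hq : ‖q‖ < 1) (n : ℕ) : Summable fun k : ℕ ↦ ‖q ^ (k + n)‖ := by
  simpa only [norm_pow] using
    (summable_nat_add_iff n).2 (summable_geometric_of_lt_one (norm_nonneg q) hq)

lemma qPochInf_neg_pow (q : ℂ) (n : ℕ) :
    qPochInf (-(q ^ (n + 1))) q = ∏' k : ℕ, (1 + q ^ (k + (n + 1))) := by
  simp only [qPochInf, neg_mul, sub_neg_eq_add, ← pow_add, add_comm]

lemma summable_norm_pow_shiftedExponent (hq : ‖q‖ < 1) (n : ℕ) :
    Summable fun s ↦ ‖q ^ shiftedExponent n s‖ := by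
  simp only [shiftedExponent, pow_add q (n ^ 2), ← prod_pow_eq_pow_sum, norm_mul, norm_prod]
  exact (summable_finsetProd_of_summable_nonneg (fun _ ↦ norm_nonneg _)
    (summable_norm_pow_add hq (n + 1))).mul_left _

lemma tsum_pow_shiftedExponent (hq : ‖q‖ < 1) (n : ℕ) :
    ∑' s, q ^ shiftedExponent n s = q ^ (n ^ 2) * qPochInf (-(q ^ (n + 1))) q := by
  simp only [shiftedExponent, pow_add q (n ^ 2), ← prod_pow_eq_pow_sum, tsum_mul_left]
  rw [qPochInf_neg_pow,
    tprod_one_add (summable_finsetProd_of_summable_norm (summable_norm_pow_add hq _))]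

lemma tsum_cardAvoiding_add (hq : ‖q‖ < 1) (n : ℕ) :
    ∑' s : cardAvoiding n, q ^ shiftedExponent n s +
      ∑' s : cardAvoiding (n + 1), q ^ shiftedExponent (n + 1) s =
      q ^ (n ^ 2) * qPochInf (-(q ^ (n + 1))) q := by
  have hs := (summable_norm_pow_shiftedExponent hq n).of_norm
  rw [← tsum_pow_shiftedExponent hq,
    ← (hs.subtype (cardAvoiding n)).tsum_add_tsum_compl (s := cardAvoiding n) (hs.subtype _),
    ← (insertCardEquiv n).tsum_eq]
  simp only [shiftedExponent_insertCardEquiv]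

lemma le_shiftedExponent (n : ℕ) (s : Finset ℕ) :
    n + shiftedExponent 0 s ≤ shiftedExponent n s := by
  have h : ∑ k ∈ s, (k + (0 + 1)) ≤ ∑ k ∈ s, (k + (n + 1)) := sum_le_sum fun _ _ ↦ by omega
  have := Nat.le_self_pow two_ne_zero n
  simp only [shiftedExponent]
  omega

lemma summable_tsum_cardAvoiding (hq : ‖q‖ < 1) :
    Summable fun n ↦ (-1) ^ n * ∑' s : cardAvoiding n, q ^ shiftedExponent n s := by
  refine ((summable_geometric_of_lt_one (norm_nonneg q) hq).mul_right
    (∑' s, ‖q ^ shiftedExponent 0 s‖)).of_norm_bounded fun n ↦ ?_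
  have hn := summable_norm_pow_shiftedExponent hq n
  rw [norm_mul, norm_pow, norm_neg, norm_one, one_pow, one_mul, ← tsum_mul_left]
  calc ‖∑' s : cardAvoiding n, q ^ shiftedExponent n s‖
      ≤ ∑' s : cardAvoiding n, ‖q ^ shiftedExponent n s‖ := norm_tsum_le_tsum_norm (hn.subtype _)
    _ ≤ ∑' s, ‖q ^ shiftedExponent n s‖ := hn.tsum_subtype_le _ _ fun _ ↦ norm_nonneg _
    _ ≤ ∑' s, ‖q‖ ^ n * ‖q ^ shiftedExponent 0 s‖ := by
      refine hn.tsum_le_tsum (fun s ↦ ?_) ((summable_norm_pow_shiftedExponent hq 0).mul_left _)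
      rw [norm_pow, norm_pow, ← pow_add]
      exact pow_le_pow_of_le_one (norm_nonneg q) hq.le (le_shiftedExponent n s)

lemma tsum_cardAvoiding_zero (hq : ‖q‖ < 1) :
    ∑' s : cardAvoiding 0, q ^ shiftedExponent 0 s =
      ∑' n : ℕ, (-1) ^ n * q ^ (n ^ 2) * qPochInf (-(q ^ (n + 1))) q := by
  have h := summable_tsum_cardAvoiding hq
  have h' := (summable_nat_add_iff 1).2 h
  have hn (n : ℕ) : (-1) ^ n * q ^ (n ^ 2) * qPochInf (-(q ^ (n + 1))) q =
      (-1) ^ n * ∑' s : cardAvoiding n, q ^ shiftedExponent n s -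
        (-1) ^ (n + 1) * ∑' s : cardAvoiding (n + 1), q ^ shiftedExponent (n + 1) s := by
    rw [mul_assoc, ← tsum_cardAvoiding_add hq]
    ring
  rw [tsum_congr hn, h.tsum_sub h', h.tsum_eq_zero_add]
  simp

end Analytic

/-- The partition of `n` into the distinct parts `k + 1`, `k ∈ s`. -/
def partitionOfFinset {n : ℕ} (s : Finset ℕ) (hs : shiftedExponent 0 s = n) : Nat.Partition n where
  parts := s.val.map (· + 1)
  parts_pos := by simp +contextual [eq_comm]
  parts_sum := by rw [← hs, shiftedExponent, zero_pow two_ne_zero, zero_add]; rfl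

lemma b_eq_card_fiber (n : ℕ) :
    b n = Nat.card ((fun s : cardAvoiding 0 ↦ shiftedExponent 0 s) ⁻¹' {n}) := by
  have hinj : Function.Injective (· + 1 : ℕ → ℕ) := add_left_injective 1
  symm
  refine Nat.card_eq_of_bijective (fun s ↦ ⟨partitionOfFinset s.1.1 s.2,
    s.1.1.nodup.map hinj, ?_⟩) ⟨?_, ?_⟩
  · obtain ⟨⟨s, hs⟩, _⟩ := s
    simpa [partitionOfFinset, cardAvoiding] using hs
  · rintro ⟨⟨s, _⟩, _⟩ ⟨⟨t, _⟩, _⟩ h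
    have h' : s.val.map (· + 1) = t.val.map (· + 1) :=
      congrArg (fun p ↦ p.1.parts) h
    simpa using Multiset.map_injective hinj h'
  · rintro ⟨p, hp, hcard⟩
    have hmap : (p.parts.map Nat.pred).map (· + 1) = p.parts := by
      rw [Multiset.map_map]
      exact (Multiset.map_congr rfl fun k hk ↦ Nat.succ_pred_eq_of_pos (p.parts_pos hk)).trans
        (Multiset.map_id _)
    have hnodup : (p.parts.map Nat.pred).Nodup := .of_map (· + 1) (hmap.symm ▸ hp)
    refine ⟨⟨⟨⟨_, hnodup⟩, fun k hk hk' ↦ hcard ?_⟩, ?_⟩,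
      Subtype.ext (Nat.Partition.ext hmap)⟩
    · rw [← hmap]
      exact Multiset.mem_map.2 ⟨k, hk, by simpa using hk'⟩
    · rw [Set.mem_preimage, Set.mem_singleton_iff, shiftedExponent, zero_pow two_ne_zero, zero_add,
        Finset.sum, hmap, p.parts_sum]

lemma tsum_b_mul_pow {q : ℂ} (hq : ‖q‖ < 1) :
    ∑' n : ℕ, (b n : ℂ) * q ^ n = ∑' s : cardAvoiding 0, q ^ shiftedExponent 0 s := by
  have hs : Summable fun s : cardAvoiding 0 ↦ q ^ shiftedExponent 0 s :=
    (summable_norm_pow_shiftedExponent hq 0).of_norm.subtype _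
  rw [← (hs.hasSum.tsum_fiberwise fun s : cardAvoiding 0 ↦ shiftedExponent 0 s).tsum_eq]
  refine tsum_congr fun n ↦ ?_
  rw [b_eq_card_fiber, ← nsmul_eq_mul, ← tsum_const]
  exact tsum_congr fun s ↦ congrArg (q ^ ·) s.2.symm

lemma one_sub_neg_mul_pow_ne_zero {q : ℂ} (hq : ‖q‖ < 1) (k : ℕ) : 1 - -q * q ^ k ≠ 0 := by
  intro h
  have h' : q ^ (k + 1) = -1 := by linear_combination h
  have := pow_lt_one₀ (norm_nonneg q) hq k.succ_ne_zero
  rw [← norm_pow, h'] at this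
  simp at this

lemma qPoch_mul_qPochInf {q : ℂ} (hq : ‖q‖ < 1) (n : ℕ) :
    qPoch (-q) q n * qPochInf (-(q ^ (n + 1))) q = qPochInf (-q) q := by
  have hm := multipliable_one_add_of_summable (summable_norm_pow_add hq (n + 1))
  have h0 := qPochInf_neg_pow q 0
  rw [zero_add, pow_one] at h0
  rw [h0, qPochInf_neg_pow, ← Multipliable.prod_mul_tprod_nat_mul'
    (f := fun k ↦ 1 + q ^ (k + 1)) (k := n) (by simpa only [add_assoc] using hm)]
  simp only [qPoch, add_assoc, neg_mul, sub_neg_eq_add, pow_succ']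

theorem nonRascoe_gen_fun (q : ℂ) (hq : ‖q‖ < 1) :
    (∑' n : ℕ, (b n : ℂ) * q ^ n = qPochInf (-q) q * sigma2 q) ∧
    (∑' n : ℕ, (b n : ℂ) * q ^ n
      = ∑' n : ℕ, (-1) ^ n * q ^ (n ^ 2) * qPochInf (-(q ^ (n + 1))) q) := by
  have h := (tsum_b_mul_pow hq).trans (tsum_cardAvoiding_zero hq)
  refine ⟨h.trans ?_, h⟩
  rw [sigma2, ← tsum_mul_left]
  refine tsum_congr fun n ↦ ?_
  have hn : qPoch (-q) q n ≠ 0 := prod_ne_zero_iff.2 fun k _ ↦ one_sub_neg_mul_pow_ne_zero hq k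
  rw [← qPoch_mul_qPochInf hq n]
  field_simp
end

section
/- For every integer n ≥ 0, the number b(n) of non-Rascoe partitions of n is odd if and only if n = m(5m+1)/2 for some integer m ∈ ℤ. -/
open Finset

section Truncated

variable {R : Type*} [CommRing R]

/-- The product side of the Rogers–Ramanujan recursion, truncated at `M`: the product
`(q)_∞` times `∑ j, q ^ (j ^ 2 + i * j) / (q)_j`. -/
def productSide (q : R) (M i : ℕ) : R :=
  ∑ j ∈ range M, q ^ (j ^ 2 + i * j) * ∏ k ∈ Ico (j + 1) M, (1 - q ^ k)

/-- The pentagonal-type exponent `n * (5 * n - 1) / 2`. -/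
def thetaExponent (n : ℕ) : ℕ := 2 * n + 5 * n.choose 2

theorem thetaExponent_succ (n : ℕ) : thetaExponent (n + 1) = thetaExponent n + (5 * n + 2) := by
  have h : (n + 1).choose 2 = n + n.choose 2 := by
    rw [Nat.choose_succ_succ' n 1, Nat.choose_one_right]
  unfold thetaExponent
  omega

theorem two_mul_thetaExponent (n : ℕ) : 2 * (thetaExponent n : ℤ) = n * (5 * n - 1) := by
  induction n with
  | zero => simp [thetaExponent]
  | succ n ih =>
    rw [thetaExponent_succ]
    push_cast
    linarith

/-- The summand of the theta side, for the recursion index `i + 1`. -/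
def thetaTerm (q : R) (i n : ℕ) : R :=
  (-1) ^ n * q ^ (thetaExponent n + 2 * (i + 1) * n) * (1 - q ^ (i + 1 + 2 * n)) *
    ∏ k ∈ range i, (1 - q ^ (n + 1 + k))

/-- The theta side of the Rogers–Ramanujan recursion at index `i + 1`, truncated at `M`. -/
def thetaSide (q : R) (M i : ℕ) : R := ∑ n ∈ range M, thetaTerm q i n

theorem productSide_rec {q : R} {M : ℕ} (hq : q ^ M = 0) (i : ℕ) :
    productSide q M i = productSide q M (i + 1) + q ^ (i + 1) * productSide q M (i + 2) := by
  rcases M with _ | M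
  · simp [productSide]
  rw [← sub_eq_iff_eq_add']
  unfold productSide
  rw [← sum_sub_distrib, sum_range_succ', sum_range_succ (n := M), mul_add, mul_sum]
  have hlast : q ^ (i + 1) * (q ^ (M ^ 2 + (i + 2) * M) *
      ∏ k ∈ Ico (M + 1) (M + 1), (1 - q ^ k)) = 0 := by
    rw [← mul_assoc, ← pow_add, pow_eq_zero_of_le (by nlinarith) hq, zero_mul]
  rw [hlast]
  simp only [ne_eq, OfNat.ofNat_ne_zero, not_false_eq_true, zero_pow, mul_zero, add_zero, sub_self]
  refine sum_congr rfl fun j hj => ?_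
  rw [prod_eq_prod_Ico_succ_bot (a := j + 1) (by simpa using hj)]
  ring

theorem productSide_of_ge {q : R} {M i : ℕ} (hq : q ^ M = 0) (h : M ≤ i) :
    productSide q M i = ∏ k ∈ Ico 1 M, (1 - q ^ k) := by
  rcases M with _ | M
  · have : Subsingleton R := subsingleton_of_zero_eq_one (by simpa using hq.symm)
    exact Subsingleton.elim _ _
  unfold productSide
  rw [sum_range_succ', sum_eq_zero]
  · simp
  · intro j _
    rw [pow_eq_zero_of_le (by nlinarith) hq, zero_mul]

/-- The telescoping certificate for the recursion of the theta side. -/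
def thetaCertificate (q : R) (i n : ℕ) : R :=
  -((-1) ^ n * q ^ (thetaExponent n + 2 * (i + 1) * n) *
    (1 + q ^ n - q ^ (i + 1 + 2 * n)) * ∏ k ∈ range (i + 1), (1 - q ^ (n + k)))

theorem thetaTerm_telescope (q : R) (i n : ℕ) :
    thetaTerm q i n - thetaTerm q (i + 1) n - q ^ (i + 2) * thetaTerm q (i + 2) n =
      thetaCertificate q i (n + 1) - thetaCertificate q i n := by
  have h : ∏ k ∈ range (i + 1), (1 - q ^ (n + k)) =
      (∏ k ∈ range i, (1 - q ^ (n + 1 + k))) * (1 - q ^ n) := by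
    rw [prod_range_succ']
    simp only [add_zero, add_right_comm n 1, add_assoc n]
  unfold thetaTerm thetaCertificate
  rw [h, thetaExponent_succ, prod_range_succ _ (i + 1), prod_range_succ _ i]
  generalize ∏ k ∈ range i, (1 - q ^ (n + 1 + k)) = P
  ring

theorem thetaSide_rec {q : R} {M : ℕ} (hq : q ^ M = 0) (i : ℕ) :
    thetaSide q M i = thetaSide q M (i + 1) + q ^ (i + 2) * thetaSide q M (i + 2) := by
  have h := sum_range_sub (thetaCertificate q i) M
  have h0 : thetaCertificate q i 0 = 0 := by simp [thetaCertificate, prod_range_succ']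
  have hM : thetaCertificate q i M = 0 := by
    rw [thetaCertificate, pow_eq_zero_of_le (by unfold thetaExponent; nlinarith) hq]
    simp
  simp only [← thetaTerm_telescope, sum_sub_distrib, ← mul_sum, h0, hM, sub_zero] at h
  unfold thetaSide
  linear_combination h

theorem thetaSide_of_ge {q : R} {M i : ℕ} (hq : q ^ M = 0) (h : M ≤ i + 1) :
    thetaSide q M i = ∏ k ∈ Ico 1 M, (1 - q ^ k) := by
  rcases M with _ | M
  · have : Subsingleton R := subsingleton_of_zero_eq_one (by simpa using hq.symm)
    exact Subsingleton.elim _ _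
  have hprod : ∏ k ∈ Ico (M + 1) (i + 2), (1 - q ^ k) = 1 := by
    refine prod_eq_one fun k hk => ?_
    rw [pow_eq_zero_of_le (mem_Ico.1 hk).1 hq, sub_zero]
  unfold thetaSide
  rw [sum_range_succ', sum_eq_zero]
  · have hsplit := prod_Ico_consecutive (fun k => 1 - q ^ k) (show 1 ≤ M + 1 by omega)
      (show M + 1 ≤ i + 2 by omega)
    rw [hprod, mul_one] at hsplit
    rw [hsplit, prod_Ico_eq_prod_range]
    simp only [thetaTerm, thetaExponent, show i + 2 - 1 = i + 1 by omega]
    rw [prod_range_succ]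
    simp [add_comm, mul_comm]
  · intro n _
    rw [thetaTerm, pow_eq_zero_of_le (by nlinarith) hq]
    simp

theorem productSide_succ_eq_thetaSide {q : R} {M : ℕ} (hq : q ^ M = 0) (i : ℕ) :
    productSide q M (i + 1) = thetaSide q M i := by
  suffices H : ∀ d i, M ≤ i + d → productSide q M (i + 1) = thetaSide q M i from
    H M i (by omega)
  intro d
  induction d using Nat.strong_induction_on with
  | _ d ih =>
    intro i hi
    by_cases h : M ≤ i + 1
    · rw [productSide_of_ge hq h, thetaSide_of_ge hq h]
    · rw [productSide_rec hq, thetaSide_rec hq, ih (d - 1) (by omega) (i + 1) (by omega),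
        ih (d - 2) (by omega) (i + 2) (by omega)]

/-- The first Rogers–Ramanujan identity, multiplied by `(q)_∞`, for nilpotent `q`. -/
theorem productSide_zero {q : R} {M : ℕ} (hq : q ^ (M + 1) = 0) :
    productSide q (M + 1) 0 =
      1 + ∑ n ∈ range M, (-1) ^ (n + 1) * q ^ thetaExponent (n + 1) * (1 + q ^ (n + 1)) := by
  rw [productSide_rec hq, productSide_succ_eq_thetaSide hq, productSide_succ_eq_thetaSide hq]
  let c : ℕ → R := fun n => -((-1) ^ n * q ^ thetaExponent n * (1 + q ^ n - q ^ (2 * n)))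
  have hterm (n : ℕ) : (-1) ^ n * q ^ thetaExponent n * (1 + q ^ n) - thetaTerm q 0 n -
      q * thetaTerm q 1 n = c (n + 1) - c n := by
    simp only [c, thetaTerm, thetaExponent_succ, prod_range_succ, prod_range_zero]
    ring
  have h := sum_range_sub c (M + 1)
  have h0 : c 0 = -1 := by simp [c, thetaExponent]
  have hM : c (M + 1) = 0 := by
    simp only [c]
    rw [pow_eq_zero_of_le (by unfold thetaExponent; nlinarith) hq]
    simp
  simp only [← hterm, sum_sub_distrib, ← mul_sum, h0, hM] at h
  rw [sum_range_succ'] at h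
  simp only [thetaSide, thetaExponent, pow_zero, Nat.choose_zero_succ, mul_zero, add_zero,
    zero_add, pow_one, mul_one] at h ⊢
  linear_combination -h

/-- The generating function, truncated at parts below `M`, of the sets `s` of positive integers
with `#s + d ∉ s`, weighted by `q ^ (∑ s + d * #s)`. -/
def nonRascoeSum (q : R) (M d : ℕ) : R :=
  ∑ s ∈ (Ico 1 M).powerset with #s + d ∉ s, q ^ (∑ k ∈ s, k + d * #s)

theorem sum_rascoe {q : R} {M : ℕ} (hq : q ^ M = 0) (d : ℕ) :
    ∑ s ∈ (Ico 1 M).powerset with #s + d ∈ s, q ^ (∑ k ∈ s, k + d * #s) =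
      q ^ (2 * d + 1) * nonRascoeSum q M (d + 1) := by
  rw [nonRascoeSum, mul_sum]
  refine sum_bij_ne_zero (fun s _ _ => s.erase (#s + d)) ?_ ?_ ?_ ?_
  · intro s hs _
    simp only [mem_filter, mem_powerset] at hs ⊢
    refine ⟨(erase_subset _ _).trans hs.1, ?_⟩
    have hc := card_erase_add_one hs.2
    rw [show #(s.erase (#s + d)) + (d + 1) = #s + d by omega]
    exact notMem_erase _ _
  · intro s hs _ t ht _ hst
    have hs' := (mem_filter.1 hs).2
    have ht' := (mem_filter.1 ht).2
    have hc : #s = #t := by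
      rw [← card_erase_add_one hs', ← card_erase_add_one ht', hst]
    rw [← insert_erase hs', ← insert_erase ht', hst, hc]
  · intro t ht hne
    simp only [mem_filter, mem_powerset] at ht
    have hlt : #t + (d + 1) < M := by
      by_contra hge
      refine hne ?_
      rw [← pow_add]
      exact pow_eq_zero_of_le (by nlinarith [Nat.zero_le (∑ k ∈ t, k)]) hq
    have hc : #(insert (#t + (d + 1)) t) = #t + 1 := card_insert_of_notMem ht.2
    have he : (insert (#t + (d + 1)) t).erase (#(insert (#t + (d + 1)) t) + d) = t := by
      rw [hc, show #t + 1 + d = #t + (d + 1) by omega, erase_insert ht.2]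
    refine ⟨insert (#t + (d + 1)) t, ?_, ?_, he⟩
    · simp only [mem_filter, mem_powerset]
      refine ⟨insert_subset (mem_Ico.2 ⟨by omega, hlt⟩) ht.1, ?_⟩
      rw [hc, show #t + 1 + d = #t + (d + 1) by omega]
      exact mem_insert_self _ _
    · convert hne using 1
      rw [← pow_add, hc, sum_insert ht.2]
      congr 1
      ring
  · intro s hs _
    have hs' := (mem_filter.1 hs).2
    rw [← pow_add]
    congr 1
    rw [← add_sum_erase s _ hs', ← card_erase_add_one hs']
    simp only [card_erase_add_one hs']
    have hc := card_erase_add_one hs'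
    generalize #(s.erase (#s + d)) = c at hc ⊢
    rw [← hc]
    ring

theorem nonRascoeSum_rec {q : R} {M : ℕ} (hq : q ^ M = 0) (d : ℕ) :
    nonRascoeSum q M d =
      ∏ k ∈ Ico (d + 1) M, (1 + q ^ k) - q ^ (2 * d + 1) * nonRascoeSum q M (d + 1) := by
  have hall : ∑ s ∈ (Ico 1 M).powerset, q ^ (∑ k ∈ s, k + d * #s) =
      ∏ k ∈ Ico 1 M, (1 + q ^ (k + d)) := by
    rw [prod_one_add]
    refine sum_congr rfl fun s _ => ?_
    rw [prod_pow_eq_pow_sum, sum_add_distrib, sum_const, smul_eq_mul, mul_comm d]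
  have hshift : ∏ k ∈ Ico 1 M, (1 + q ^ (k + d)) = ∏ k ∈ Ico (d + 1) M, (1 + q ^ k) := by
    rw [prod_Ico_add' (fun k => 1 + q ^ k) 1 M d, add_comm 1 d]
    refine (prod_subset (Ico_subset_Ico_right (by omega)) fun k hk hk' => ?_).symm
    simp only [mem_Ico] at hk hk'
    rw [pow_eq_zero_of_le (by omega) hq, add_zero]
  rw [← sum_rascoe hq, ← hshift, ← hall, nonRascoeSum, eq_sub_iff_add_eq, add_comm]
  exact sum_filter_add_sum_filter_not _ _ _

theorem nonRascoeSum_zero_eq {q : R} {M : ℕ} (hq : q ^ M = 0) :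
    nonRascoeSum q M 0 =
      ∑ j ∈ range M, (-1) ^ j * q ^ j ^ 2 * ∏ k ∈ Ico (j + 1) M, (1 + q ^ k) := by
  have key (m : ℕ) : nonRascoeSum q M 0 =
      ∑ j ∈ range m, (-1) ^ j * q ^ j ^ 2 * ∏ k ∈ Ico (j + 1) M, (1 + q ^ k) +
        (-1) ^ m * q ^ m ^ 2 * nonRascoeSum q M m := by
    induction m with
    | zero => simp
    | succ m ih =>
      rw [ih, nonRascoeSum_rec hq m, sum_range_succ]
      ring
  rw [key M, pow_eq_zero_of_le (by nlinarith : M ≤ M ^ 2) hq]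
  simp

theorem nonRascoeSum_zero_of_neg_one_eq_one (h2 : (-1 : R) = 1) {q : R} {M : ℕ}
    (hq : q ^ (M + 1) = 0) :
    nonRascoeSum q (M + 1) 0 =
      1 + ∑ n ∈ range M, (q ^ thetaExponent (n + 1) + q ^ (thetaExponent (n + 1) + (n + 1))) := by
  have hsub (x y : R) : x - y = x + y := by linear_combination y * h2
  have h := productSide_zero hq
  rw [productSide] at h
  rw [nonRascoeSum_zero_eq hq]
  simpa [h2, hsub, mul_add, pow_add] using h

theorem map_nonRascoeSum {S : Type*} [CommRing S] (f : R →+* S) (q : R) (M d : ℕ) :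
    f (nonRascoeSum q M d) = nonRascoeSum (f q) M d := by
  simp [nonRascoeSum]

end Truncated

theorem sum_Icc_neg_eq {A : Type*} [AddCommMonoid A] (f : ℤ → A) (M : ℕ) :
    ∑ m ∈ Icc (-(M : ℤ)) M, f m =
      f 0 + ∑ k ∈ range M, (f (-((k + 1 : ℕ) : ℤ)) + f ((k + 1 : ℕ) : ℤ)) := by
  induction M with
  | zero => simp
  | succ M ih =>
    have h : Icc (-((M + 1 : ℕ) : ℤ)) ((M + 1 : ℕ) : ℤ) =
        insert (-((M + 1 : ℕ) : ℤ)) (insert ((M + 1 : ℕ) : ℤ) (Icc (-(M : ℤ)) M)) := by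
      ext m
      simp only [mem_insert, mem_Icc]
      omega
    rw [h, sum_insert (by simp only [mem_insert, mem_Icc]; omega),
      sum_insert (by simp only [mem_Icc]; omega), ih, sum_range_succ]
    abel

theorem eq_of_mul_five_mul_add_one_eq {m k : ℤ} (h : m * (5 * m + 1) = k * (5 * k + 1)) :
    m = k := by
  have h' : (m - k) * (5 * (m + k) + 1) = 0 := by linear_combination h
  rcases mul_eq_zero.1 h' with h' | h' <;> omega

open Polynomial in
theorem coeff_nonRascoeSum_X (n : ℕ) :
    (nonRascoeSum (X : (ZMod 2)[X]) (n + 1) 0).coeff n =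
      ∑ m ∈ Icc (-(n : ℤ)) n, if 2 * (n : ℤ) = m * (5 * m + 1) then 1 else 0 := by
  let P : (ZMod 2)[X] :=
    1 + ∑ k ∈ range n, (X ^ thetaExponent (k + 1) + X ^ (thetaExponent (k + 1) + (k + 1)))
  let I : Ideal (ZMod 2)[X] := Ideal.span {X ^ (n + 1)}
  have hq : (Ideal.Quotient.mk I X) ^ (n + 1) = 0 := by
    rw [← map_pow]
    exact Ideal.Quotient.eq_zero_iff_mem.2 (Ideal.mem_span_singleton_self _)
  have h2 : (-1 : (ZMod 2)[X] ⧸ I) = 1 := by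
    have := congrArg (Ideal.Quotient.mk I) (CharTwo.neg_eq (1 : (ZMod 2)[X]))
    simpa using this
  have hmk : Ideal.Quotient.mk I (nonRascoeSum X (n + 1) 0) = Ideal.Quotient.mk I P := by
    rw [map_nonRascoeSum, nonRascoeSum_zero_of_neg_one_eq_one h2 hq]
    simp [P]
  have hdvd := Ideal.mem_span_singleton.1 (Ideal.Quotient.eq.1 hmk)
  have hcoeff := X_pow_dvd_iff.1 hdvd n (by omega)
  rw [coeff_sub, sub_eq_zero] at hcoeff
  rw [hcoeff, sum_Icc_neg_eq]
  simp only [P, coeff_add, finsetSum_coeff, coeff_X_pow, coeff_one]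
  congr 1
  · simp
  · refine sum_congr rfl fun k _ => ?_
    have hk := two_mul_thetaExponent (k + 1)
    push_cast at hk
    congr 1 <;> refine if_congr ?_ rfl rfl <;> push_cast <;> constructor <;> intro h
    · subst h; linarith
    · zify; linarith
    · rw [h]; push_cast; linarith
    · zify; linarith

theorem b_eq_card (n : ℕ) :
    b n = #{s ∈ (Ico 1 (n + 1)).powerset | #s ∉ s ∧ ∑ k ∈ s, k = n} := by
  rw [b, ← Nat.card_eq_finsetCard]
  refine Nat.card_eq_of_bijective (fun p => ⟨⟨p.1.parts, p.2.1⟩, ?_⟩) ⟨?_, ?_⟩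
  · obtain ⟨p, hnodup, hcard⟩ := p
    simp only [mem_filter, mem_powerset]
    refine ⟨fun k hk => mem_Ico.2 ⟨p.parts_pos hk, ?_⟩, hcard, ?_⟩
    · have := Multiset.le_sum_of_mem (show k ∈ p.parts from hk)
      rw [p.parts_sum] at this
      omega
    · rw [Finset.sum, Multiset.map_id']
      exact p.parts_sum
  · rintro ⟨p, hp⟩ ⟨p', hp'⟩ h
    simp only [Subtype.mk.injEq, Finset.mk.injEq] at h
    exact Subtype.ext (Nat.Partition.ext h)
  · rintro ⟨s, hs⟩
    simp only [mem_filter, mem_powerset] at hs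
    refine ⟨⟨⟨s.1, fun hk => (mem_Ico.1 (hs.1 hk)).1, ?_⟩, s.2, hs.2.1⟩, rfl⟩
    have := hs.2.2
    rwa [Finset.sum, Multiset.map_id'] at this

theorem b_cast_eq_coeff (n : ℕ) :
    (b n : ZMod 2) = (nonRascoeSum (Polynomial.X : Polynomial (ZMod 2)) (n + 1) 0).coeff n := by
  simp only [b_eq_card, nonRascoeSum, Polynomial.finsetSum_coeff, Polynomial.coeff_X_pow,
    sum_boole, filter_filter, add_zero, zero_mul, eq_comm (a := n)]

theorem nonRascoe_parity (n : ℕ) :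
    Odd (b n) ↔ ∃ m : ℤ, 2 * (n : ℤ) = m * (5 * m + 1) := by
  rw [← ZMod.natCast_eq_one_iff_odd, b_cast_eq_coeff, coeff_nonRascoeSum_X]
  constructor
  · intro h
    obtain ⟨m, -, hm⟩ := exists_ne_zero_of_sum_ne_zero (h.trans_ne one_ne_zero)
    exact ⟨m, by simpa using hm⟩
  · rintro ⟨m, hm⟩
    rw [sum_eq_single m, if_pos hm]
    · intro k _ hk
      exact if_neg fun h => hk (eq_of_mul_five_mul_add_one_eq (h.symm.trans hm))
    · intro hmem
      refine absurd (mem_Icc.2 ⟨?_, ?_⟩) hmem <;> nlinarith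
end

section
/- For every integer n ≥ 0, ∑_{j=0}^{n} (-1)^j P(j,n) = b(n). That is, the excess of the number of partitions counted by P(j,n) with j even over those with j odd equals the number of non-Rascoe partitions of n. -/
open scoped BigOperators

/-- For `j ≥ 1`, `P j n` is the number of partitions of `n` with smallest part `j`, where
`j` occurs exactly `j` times and all parts larger than `j` are distinct; `P 0 n` is the
number of partitions of `n` into distinct parts. -/
noncomputable def P (j n : ℕ) : ℕ :=
  if j = 0 then Nat.card {p : Nat.Partition n // p.parts.Nodup}
  else Nat.card {p : Nat.Partition n //
    (∀ a ∈ p.parts, j ≤ a) ∧ p.parts.count j = j ∧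
      (p.parts.filter (fun a => j < a)).Nodup}

/-- The finite sets `T` of integers larger than `j` whose sum is `n - j ^ 2`. -/
def distinctTails (j n : ℕ) : Finset (Finset ℕ) :=
  (Finset.range (n + 1)).powerset.filter
    fun T => (∀ a ∈ T, j < a) ∧ j ^ 2 + ∑ a ∈ T, a = n

/-- The members `T` of `distinctTails j n` that do not contain `T.card + 2 * j`. -/
def avoidingTails (j n : ℕ) : Finset (Finset ℕ) :=
  (distinctTails j n).filter fun T => T.card + 2 * j ∉ T

theorem mem_distinctTails {j n : ℕ} {T : Finset ℕ} :
    T ∈ distinctTails j n ↔ (∀ a ∈ T, j < a) ∧ j ^ 2 + ∑ a ∈ T, a = n := by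
  simp only [distinctTails, Finset.mem_filter, Finset.mem_powerset, and_iff_right_iff_imp]
  rintro ⟨-, h⟩ a ha
  have := Finset.single_le_sum (f := fun a : ℕ => a) (fun _ _ => Nat.zero_le _) ha
  simp only [Finset.mem_range]
  omega

theorem mem_avoidingTails {j n : ℕ} {T : Finset ℕ} :
    T ∈ avoidingTails j n ↔
      ((∀ a ∈ T, j < a) ∧ j ^ 2 + ∑ a ∈ T, a = n) ∧ T.card + 2 * j ∉ T := by
  rw [avoidingTails, Finset.mem_filter, mem_distinctTails]

theorem sum_map_addRightEmbedding_one (T : Finset ℕ) :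
    ∑ a ∈ T.map (addRightEmbedding 1), a = ∑ a ∈ T, a + T.card := by
  simp [Finset.sum_add_distrib]

/-- Removing the element `T.card + 2 * j` and increasing every other element by one is a bijection
from the members of `distinctTails j n` that contain `T.card + 2 * j` to
`avoidingTails (j + 1) n`. -/
theorem card_filter_mem_distinctTails (j n : ℕ) :
    ((distinctTails j n).filter fun T => T.card + 2 * j ∈ T).card =
      (avoidingTails (j + 1) n).card := by
  refine Finset.card_bij
    (fun T _ => (T.erase (T.card + 2 * j)).map (addRightEmbedding 1)) ?_ ?_ ?_
  · intro T hT
    rw [Finset.mem_filter, mem_distinctTails] at hT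
    obtain ⟨⟨hlt, hsum⟩, hmem⟩ := hT
    have hcard := Finset.card_erase_add_one hmem
    have herase := Finset.sum_erase_add T (fun a : ℕ => a) hmem
    rw [mem_avoidingTails]
    refine ⟨⟨?_, ?_⟩, ?_⟩
    · simp only [Finset.mem_map, addRightEmbedding_apply]
      rintro _ ⟨a, ha, rfl⟩
      have := hlt a (Finset.mem_of_mem_erase ha)
      omega
    · rw [sum_map_addRightEmbedding_one]
      nlinarith
    · simp only [Finset.mem_map, addRightEmbedding_apply, Finset.card_map]
      rintro ⟨a, ha, h⟩
      exact Finset.ne_of_mem_erase ha (by omega)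
  · intro S hS T hT h
    rw [Finset.mem_filter] at hS hT
    have h' := Finset.map_injective _ h
    have hS' := Finset.card_erase_add_one hS.2
    have hT' := Finset.card_erase_add_one hT.2
    have hcard : S.card = T.card := by rw [← hS', ← hT', h']
    rw [← Finset.insert_erase hS.2, h', hcard, Finset.insert_erase hT.2]
  · intro U hU
    rw [mem_avoidingTails] at hU
    obtain ⟨⟨hlt, hsum⟩, hmem⟩ := hU
    obtain ⟨V, rfl⟩ : ∃ V : Finset ℕ, V.map (addRightEmbedding 1) = U := by
      refine ⟨U.image (· - 1), ?_⟩
      ext a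
      simp only [Finset.mem_map, Finset.mem_image, addRightEmbedding_apply]
      constructor
      · rintro ⟨_, ⟨c, hc, rfl⟩, rfl⟩
        have := hlt c hc
        rwa [Nat.sub_add_cancel (by omega)]
      · intro ha
        have := hlt a ha
        exact ⟨_, ⟨a, ha, rfl⟩, by omega⟩
    rw [sum_map_addRightEmbedding_one] at hsum
    simp only [Finset.mem_map, addRightEmbedding_apply, Finset.card_map] at hmem hlt
    have hnot : V.card + 1 + 2 * j ∉ V := fun h => hmem ⟨_, h, by ring⟩
    have hcard := Finset.card_insert_of_notMem hnot
    refine ⟨insert (V.card + 1 + 2 * j) V, ?_, ?_⟩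
    · rw [Finset.mem_filter, mem_distinctTails, hcard, Finset.sum_insert hnot]
      refine ⟨⟨?_, by nlinarith⟩, Finset.mem_insert_self _ _⟩
      intro a ha
      rcases Finset.mem_insert.mp ha with rfl | ha
      · omega
      · have := hlt _ ⟨a, ha, rfl⟩
        omega
    · rw [hcard, Finset.erase_insert hnot]

theorem card_distinctTails (j n : ℕ) :
    (distinctTails j n).card = (avoidingTails j n).card + (avoidingTails (j + 1) n).card := by
  rw [← card_filter_mem_distinctTails, avoidingTails, add_comm,
    Finset.card_filter_add_card_filter_not]

theorem avoidingTails_eq_empty {j n : ℕ} (h : n < j ^ 2) : avoidingTails j n = ∅ := by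
  refine Finset.eq_empty_of_forall_notMem fun T hT => ?_
  rw [mem_avoidingTails] at hT
  omega

theorem filter_not_lt_eq_replicate {s : Multiset ℕ} {j k : ℕ} (hle : ∀ a ∈ s, j ≤ a)
    (hcount : s.count j = k) : s.filter (fun a => ¬ j < a) = Multiset.replicate k j := by
  rw [← hcount, ← Multiset.filter_eq']
  refine Multiset.filter_congr fun a ha => ?_
  have := hle a ha
  omega

/-- Deleting the copies of `j` identifies the partitions counted by `P j n` with
`distinctTails j n`. -/
def partitionEquivDistinctTails (j n : ℕ) :
    {p : Nat.Partition n // (∀ a ∈ p.parts, j ≤ a) ∧ p.parts.count j = j ∧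
      (p.parts.filter (fun a => j < a)).Nodup} ≃ {T // T ∈ distinctTails j n} where
  toFun p := ⟨⟨p.1.parts.filter (fun a => j < a), p.2.2.2⟩, by
    obtain ⟨p, hle, hcount, -⟩ := p
    rw [mem_distinctTails]
    refine ⟨fun a ha => (Multiset.mem_filter.mp ha).2, ?_⟩
    have hsplit := congrArg Multiset.sum
      (Multiset.filter_add_not (fun a => j < a) p.parts)
    have heq : p.parts.filter (fun a => ¬ j < a) = Multiset.replicate j j :=
      filter_not_lt_eq_replicate hle hcount
    rw [Multiset.sum_add, heq, p.parts_sum, Multiset.sum_replicate, smul_eq_mul] at hsplit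
    simp only [Finset.sum, Multiset.map_id']
    rw [sq, add_comm]
    exact hsplit⟩
  invFun T := ⟨⟨Multiset.replicate j j + T.1.val, by
      intro a ha
      rcases Multiset.mem_add.mp ha with ha | ha
      · obtain ⟨h, rfl⟩ := Multiset.mem_replicate.mp ha
        omega
      · have := (mem_distinctTails.mp T.2).1 a ha
        omega, by
      have := (mem_distinctTails.mp T.2).2
      simp only [Finset.sum, Multiset.map_id'] at this
      rw [Multiset.sum_add, Multiset.sum_replicate, smul_eq_mul, ← sq, this]⟩, by
    have hlt := (mem_distinctTails.mp T.2).1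
    refine ⟨?_, ?_, ?_⟩
    · intro a ha
      rcases Multiset.mem_add.mp ha with ha | ha
      · exact (Multiset.eq_of_mem_replicate ha).ge
      · exact (hlt a ha).le
    · rw [Multiset.count_add, Multiset.count_replicate_self,
        Multiset.count_eq_zero_of_notMem fun h => (hlt j h).false, add_zero]
    · rw [Multiset.filter_add, Multiset.filter_eq_nil.mpr, zero_add]
      · exact T.1.nodup.filter _
      · intro a ha
        exact (Multiset.eq_of_mem_replicate ha).not_gt⟩
  left_inv := by
    rintro ⟨p, hle, hcount, -⟩
    refine Subtype.ext (Nat.Partition.ext ?_)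
    have heq : p.parts.filter (fun a => ¬ j < a) = Multiset.replicate j j :=
      filter_not_lt_eq_replicate hle hcount
    change Multiset.replicate j j + p.parts.filter (fun a => j < a) = p.parts
    rw [← heq, add_comm, Multiset.filter_add_not]
  right_inv := by
    rintro ⟨T, hT⟩
    refine Subtype.ext (Finset.val_injective ?_)
    change (Multiset.replicate j j + T.val).filter (fun a => j < a) = T.val
    rw [Multiset.filter_add, Multiset.filter_eq_nil.mpr, zero_add, Multiset.filter_eq_self]
    · exact (mem_distinctTails.mp hT).1
    · intro a ha
      exact (Multiset.eq_of_mem_replicate ha).not_gt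

theorem Nat.Partition.filter_pos_parts {n : ℕ} (p : Nat.Partition n) :
    p.parts.filter (fun a => 0 < a) = p.parts :=
  Multiset.filter_eq_self.mpr fun _ => p.parts_pos

theorem Nat.Partition.nodup_parts_iff {n : ℕ} (p : Nat.Partition n) :
    p.parts.Nodup ↔ (∀ a ∈ p.parts, 0 ≤ a) ∧ p.parts.count 0 = 0 ∧
      (p.parts.filter (fun a => 0 < a)).Nodup := by
  rw [p.filter_pos_parts, Multiset.count_eq_zero]
  exact ⟨fun h => ⟨fun _ _ => Nat.zero_le _, fun h0 => (p.parts_pos h0).false, h⟩,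
    fun h => h.2.2⟩

theorem P_eq_card_distinctTails (j n : ℕ) : P j n = (distinctTails j n).card := by
  have key := Nat.card_congr (partitionEquivDistinctTails j n)
  rw [Nat.card_eq_fintype_card (α := {T // T ∈ distinctTails j n}), Fintype.card_coe] at key
  rw [P, ← key]
  split_ifs with h
  · subst h
    exact Nat.card_congr (Equiv.subtypeEquivRight fun p => p.nodup_parts_iff)
  · rfl

theorem b_eq_card_avoidingTails (n : ℕ) : b n = (avoidingTails 0 n).card := by
  rw [← Fintype.card_coe, ← Nat.card_eq_fintype_card, b]
  refine Nat.card_congr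
    { toFun := fun p => ⟨⟨p.1.parts, p.2.1⟩, ?_⟩
      invFun := fun T => ⟨⟨T.1.val, ?_, ?_⟩, ?_⟩
      left_inv := fun _ => rfl
      right_inv := fun _ => rfl }
  · rw [mem_avoidingTails]
    refine ⟨⟨fun a => p.1.parts_pos, ?_⟩, p.2.2⟩
    rw [Finset.sum, Multiset.map_id', zero_pow two_ne_zero, zero_add]
    exact p.1.parts_sum
  · exact fun {a} => (mem_avoidingTails.mp T.2).1.1 a
  · have := (mem_avoidingTails.mp T.2).1.2
    rwa [Finset.sum, Multiset.map_id', zero_pow two_ne_zero, zero_add] at this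
  · exact ⟨T.1.nodup, (mem_avoidingTails.mp T.2).2⟩

theorem alternating_sum_distinctTails (m n : ℕ) :
    ∑ j ∈ Finset.range m, (-1 : ℤ) ^ j * ((distinctTails j n).card : ℤ) =
      (avoidingTails 0 n).card - (-1) ^ m * (avoidingTails m n).card := by
  induction m with
  | zero => simp
  | succ m ih =>
    rw [Finset.sum_range_succ, ih, card_distinctTails]
    push_cast
    ring

theorem alternating_sum_P_eq_b (n : ℕ) :
    (∑ j ∈ Finset.range (n + 1), (-1 : ℤ) ^ j * (P j n : ℤ)) = (b n : ℤ) := by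
  simp only [P_eq_card_distinctTails]
  rw [alternating_sum_distinctTails, avoidingTails_eq_empty (j := n + 1) (by nlinarith),
    b_eq_card_avoidingTails]
  simp
end

section
/- For every complex q with 0 < |q| < 1, σ₂(q) = (1/(-q;q)_∞) · { 1 + ∑_{n=1}^{∞} [ (-1)^n q^{n(5n-1)/2} (1 + q^{2n}) / (1 + q^n) ] · ∑_{j=0}^{n} [ (-1;q)_j / (q;q)_j ] (-q^{1-n})^j }. -/
open scoped BigOperators

theorem qPoch_succ (a q : ℂ) (n : ℕ) :
    qPoch a q (n + 1) = qPoch a q n * (1 - a * q ^ n) :=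
  Finset.prod_range_succ _ _

theorem qPoch_zero (a q : ℂ) : qPoch a q 0 = 1 := Finset.prod_range_zero _

theorem qPoch_add (a q : ℂ) (m n : ℕ) :
    qPoch a q (m + n) = qPoch a q m * qPoch (a * q ^ m) q n := by
  simp only [qPoch, Finset.prod_range_add, pow_add, mul_assoc]

theorem qPoch_succ' (a q : ℂ) (n : ℕ) :
    qPoch a q (n + 1) = (1 - a) * qPoch (a * q) q n := by
  rw [add_comm, qPoch_add]
  simp [qPoch]

theorem qPoch_ne_zero {a q : ℂ} (h : ∀ k : ℕ, 1 - a * q ^ k ≠ 0) (n : ℕ) : qPoch a q n ≠ 0 :=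
  Finset.prod_ne_zero_iff.2 fun k _ => h k

/-- The finite form of Cauchy's identity `∑ q^{m²} z^m / ((q;q)_m (zq;q)_m) = 1 / (zq;q)_∞`. -/
theorem sum_cauchy {q : ℂ} (hq : ∀ k : ℕ, 1 - q * q ^ k ≠ 0) (K : ℕ) :
    ∀ z : ℂ, (∀ k : ℕ, 1 - z * q * q ^ k ≠ 0) →
    ∑ m ∈ Finset.range (K + 1),
      q ^ (m ^ 2) * z ^ m / (qPoch q q (K - m) * qPoch q q m * qPoch (z * q) q m) =
    1 / (qPoch q q K * qPoch (z * q) q K) := by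
  induction K with
  | zero => intro z _; simp [qPoch_zero]
  | succ K ih =>
    intro z hz
    have hzq : ∀ k : ℕ, 1 - z * q * q * q ^ k ≠ 0 := fun k => by
      have := hz (k + 1); rwa [pow_succ', ← mul_assoc] at this
    have hP := qPoch_ne_zero hq
    have hZ := qPoch_ne_zero hz
    have hZ' := qPoch_ne_zero hzq
    have hz0 : 1 - z * q ≠ 0 := by simpa using hz 0
    have key : (1 - q * q ^ K) * ∑ m ∈ Finset.range (K + 1 + 1),
        q ^ (m ^ 2) * z ^ m / (qPoch q q (K + 1 - m) * qPoch q q m * qPoch (z * q) q m) =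
        ∑ m ∈ Finset.range (K + 1),
          q ^ (m ^ 2) * z ^ m / (qPoch q q (K - m) * qPoch q q m * qPoch (z * q) q m) +
        z * q * q ^ K / (1 - z * q) * ∑ m ∈ Finset.range (K + 1),
          q ^ (m ^ 2) * (z * q) ^ m /
            (qPoch q q (K - m) * qPoch q q m * qPoch (z * q * q) q m) := by
      have split : ∀ m ∈ Finset.range (K + 1 + 1), (1 - q * q ^ K) *
          (q ^ (m ^ 2) * z ^ m / (qPoch q q (K + 1 - m) * qPoch q q m * qPoch (z * q) q m)) =
          (1 - q ^ (K + 1 - m)) *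
            (q ^ (m ^ 2) * z ^ m / (qPoch q q (K + 1 - m) * qPoch q q m * qPoch (z * q) q m)) +
          q ^ (K + 1 - m) * (1 - q ^ m) *
            (q ^ (m ^ 2) * z ^ m /
              (qPoch q q (K + 1 - m) * qPoch q q m * qPoch (z * q) q m)) := by
        intro m hm
        have : q * q ^ K = q ^ (K + 1 - m) * q ^ m := by
          rw [← pow_add, ← pow_succ']; congr 1; have := Finset.mem_range.1 hm; omega
        rw [this]; ring
      rw [Finset.mul_sum, Finset.sum_congr rfl split, Finset.sum_add_distrib]
      congr 1
      · rw [Finset.sum_range_succ]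
        simp only [Nat.sub_self, pow_zero, sub_self, zero_mul, add_zero]
        refine Finset.sum_congr rfl fun m hm => ?_
        obtain ⟨p, rfl⟩ := Nat.exists_eq_add_of_le (Nat.lt_succ_iff.1 (Finset.mem_range.1 hm))
        have e1 : m + p + 1 - m = p + 1 := by omega
        have e2 : m + p - m = p := by omega
        rw [e1, e2, qPoch_succ, pow_succ']
        have := hP p; have := hP m; have := hZ m; have := hq p
        field_simp
      · rw [Finset.sum_range_succ', Finset.mul_sum]
        simp only [pow_zero, sub_self, mul_zero, zero_mul, add_zero]
        refine Finset.sum_congr rfl fun m hm => ?_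
        obtain ⟨p, rfl⟩ := Nat.exists_eq_add_of_le (Nat.lt_succ_iff.1 (Finset.mem_range.1 hm))
        have e1 : m + p + 1 - (m + 1) = p := by omega
        have e2 : m + p - m = p := by omega
        rw [e1, e2, qPoch_succ q, qPoch_succ' (z * q)]
        have := hP p; have := hP m; have := hZ' m; have := hq m
        have e3 : q ^ (m + 1) = q * q ^ m := pow_succ' _ _
        rw [e3]
        field_simp
        ring
    have h1 := hq K
    rw [ih z hz, ih (z * q) hzq] at key
    have h2 : (1 - z * q) * qPoch (z * q * q) q K = qPoch (z * q) q K * (1 - z * q * q ^ K) := by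
      rw [← qPoch_succ', qPoch_succ]
    have h3 : z * q * q ^ K / (1 - z * q) * (1 / (qPoch q q K * qPoch (z * q * q) q K)) =
        z * q * q ^ K / (qPoch q q K * (qPoch (z * q) q K * (1 - z * q * q ^ K))) := by
      rw [← h2]; have := hP K; have := hZ' K; field_simp
    rw [h3] at key
    apply mul_left_cancel₀ h1
    rw [key, qPoch_succ, qPoch_succ]
    have := hP K; have := hZ K; have := hz K
    field_simp
    ring

/-- Partial sums of the very-well-poised series behind Bailey inversion. -/
theorem sum_wellPoised_partial {a q : ℂ} (hq : ∀ k : ℕ, 1 - q * q ^ k ≠ 0)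
    (ha : ∀ k : ℕ, 1 - a * q * q ^ k ≠ 0) (m : ℕ) : ∀ p : ℕ,
    ∑ k ∈ Finset.range (m + 1), (1 - a * q ^ (2 * k)) * qPoch a q k * (-1) ^ k * q ^ (k.choose 2) /
      (qPoch q q k * qPoch q q (m + 1 + p - k) * qPoch (a * q) q (m + 1 + p + k)) =
    (-1) ^ m * q ^ ((m + 1).choose 2) * qPoch a q (m + 1) /
      (qPoch q q m * qPoch q q p * qPoch (a * q) q (m + 1 + p + m) * (1 - q * q ^ (m + p))) := by
  have hP := qPoch_ne_zero hq
  have hZ := qPoch_ne_zero ha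
  induction m with
  | zero =>
    intro p
    have h1 : qPoch a q 1 = 1 - a := by simp [qPoch]
    simp only [zero_add, Finset.sum_range_one, Nat.sub_zero, add_zero, add_comm 1 p, h1, qPoch_zero,
      qPoch_succ q q p]
    have := hP p; have := hq p; have := hZ (p + 1)
    simp
    field_simp
  | succ m ih =>
    intro p
    rw [Finset.sum_range_succ]
    have e1 : m + 1 + 1 + p = m + 1 + (p + 1) := by omega
    rw [e1, ih (p + 1)]
    have e2 : m + 1 + (p + 1) - (m + 1) = p + 1 := by omega
    have e3 : m + 1 + (p + 1) + (m + 1) = (m + 1 + (p + 1) + m) + 1 := by omega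
    have e4 : (m + 1 + 1).choose 2 = (m + 1).choose 2 + (m + 1) := by
      rw [Nat.choose_succ_succ' (m + 1) 1, Nat.choose_one_right, add_comm]
    rw [e2, e3, e4, qPoch_succ q q m, qPoch_succ q q p, qPoch_succ (a * q),
      qPoch_succ a q (m + 1)]
    have := hP p; have := hq p; have := hP m; have := hq m
    have := hZ (m + 1 + (p + 1) + m); have := ha (m + 1 + (p + 1) + m)
    have := hq (m + 1 + p)
    rw [show m + (p + 1) = m + 1 + p by omega]
    have x1 : q ^ (m + 1 + (p + 1) + m) = q ^ 2 * (q ^ m) ^ 2 * q ^ p := by ring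
    have x2 : q ^ (m + 1 + p) = q * q ^ m * q ^ p := by ring
    have x3 : q ^ (2 * (m + 1)) = q ^ 2 * (q ^ m) ^ 2 := by ring
    have x4 : q ^ ((m + 1).choose 2 + (m + 1)) = q ^ ((m + 1).choose 2) * (q * q ^ m) := by ring
    have x5 : q ^ (m + 1) = q * q ^ m := by ring
    simp only [x1, x2, x3, x4, x5, pow_succ (-1 : ℂ) m] at *
    generalize q ^ m = x at *
    generalize q ^ p = y at *
    generalize qPoch (a * q) q (m + 1 + (p + 1) + m) = Z at *
    obtain ⟨u, hu⟩ : ∃ u, u = 1 - q * (q * x * y) := ⟨_, rfl⟩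
    obtain ⟨v, hv⟩ : ∃ v, v = 1 - a * q * (q ^ 2 * x ^ 2 * y) := ⟨_, rfl⟩
    have hu0 : u ≠ 0 := by rw [hu]; assumption
    have hv0 : v ≠ 0 := by rw [hv]; assumption
    rw [← hu, ← hv]
    field_simp
    rw [hu, hv]
    ring

theorem sum_wellPoised {a q : ℂ} (hq : ∀ k : ℕ, 1 - q * q ^ k ≠ 0)
    (ha : ∀ k : ℕ, 1 - a * q * q ^ k ≠ 0) (m : ℕ) :
    ∑ k ∈ Finset.range (m + 1 + 1),
      (1 - a * q ^ (2 * k)) * qPoch a q k * (-1) ^ k * q ^ (k.choose 2) /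
      (qPoch q q k * qPoch q q (m + 1 - k) * qPoch (a * q) q (m + 1 + k)) = 0 := by
  have h := sum_wellPoised_partial hq ha m 0
  have hP := qPoch_ne_zero hq
  have hZ := qPoch_ne_zero ha
  simp only [add_zero] at h
  rw [Finset.sum_range_succ, h, Nat.sub_self, qPoch_zero,
    show m + 1 + (m + 1) = m + 1 + m + 1 by omega, qPoch_succ (a * q), qPoch_succ q]
  have := hP m; have := hq m
  have := hZ (m + 1 + m); have := ha (m + 1 + m)
  field_simp
  ring

/-- The summand of the terminating series obtained by inverting the Bailey pair relative to `-1`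
with `β_n = 1 / (-q;q)_n`. -/
noncomputable def inversionTerm (q : ℂ) (n k : ℕ) : ℂ :=
  qPoch (-1) q (2 * n - k) * (-1) ^ k * q ^ (k.choose 2) /
    (2 * (qPoch q q k * qPoch (-q) q (n - k)))

/-- The terminating series obtained by inverting the Bailey pair relative to `-1` with
`β_n = 1 / (-q;q)_n`. -/
noncomputable def inversionSum (q : ℂ) (n : ℕ) : ℂ :=
  ∑ k ∈ Finset.range (n + 1), inversionTerm q n k

/-- The sequence `α_n` of the Bailey pair relative to `-1` with `β_n = 1 / (-q;q)_n`. -/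
noncomputable def baileyAlpha (q : ℂ) (n : ℕ) : ℂ := (1 + q ^ (2 * n)) * inversionSum q n

theorem qPoch_neg_one_succ (q : ℂ) (n : ℕ) : qPoch (-1) q (n + 1) = 2 * qPoch (-q) q n := by
  rw [qPoch_succ']; norm_num

theorem sum_baileyAlpha {q : ℂ} (hq : ∀ k : ℕ, 1 - q * q ^ k ≠ 0)
    (hm : ∀ k : ℕ, 1 - -q * q ^ k ≠ 0) (N : ℕ) :
    ∑ r ∈ Finset.range (N + 1),
      baileyAlpha q r / (qPoch q q (N - r) * qPoch (-q) q (N + r)) = 1 / qPoch (-q) q N := by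
  have hP := qPoch_ne_zero hq
  have hM := qPoch_ne_zero hm
  let f : ℕ → ℕ → ℂ := fun j k =>
    (1 + q ^ (2 * (j + k))) * (qPoch (-1) q (2 * j + k) * (-1) ^ k * q ^ (k.choose 2) /
    (2 * (qPoch q q k * qPoch (-q) q j))) / (qPoch q q (N - (j + k)) * qPoch (-q) q (N + (j + k)))
  have e1 : ∀ r ∈ Finset.range (N + 1),
      baileyAlpha q r / (qPoch q q (N - r) * qPoch (-q) q (N + r)) =
      ∑ j ∈ Finset.range (r + 1), f j (r - j) := by
    intro r _
    rw [baileyAlpha, inversionSum, ← Finset.sum_flip, Finset.mul_sum, Finset.sum_div]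
    refine Finset.sum_congr rfl fun j hj => ?_
    obtain ⟨p, rfl⟩ := Nat.exists_eq_add_of_le (Nat.lt_succ_iff.1 (Finset.mem_range.1 hj))
    have a1 : j + p - j = p := by omega
    have a2 : 2 * (j + p) - p = 2 * j + p := by omega
    have a3 : j + p - p = j := by omega
    simp only [f, inversionTerm, a1, a2, a3]
  rw [Finset.sum_congr rfl e1, Finset.sum_range_diag_flip, Finset.sum_range_succ,
    Finset.sum_eq_zero, zero_add]
  · rw [Nat.add_sub_cancel_left, Finset.sum_range_one]
    simp only [f, add_zero, Nat.sub_self, qPoch_zero]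
    have h := qPoch_neg_one_succ q (2 * N)
    rw [qPoch_succ] at h
    rw [← two_mul]
    have := hM N; have := hM (2 * N)
    simp
    field_simp
    linear_combination h
  · intro j hj
    obtain ⟨p, rfl⟩ := Nat.exists_eq_add_of_lt (Finset.mem_range.1 hj)
    have a1 : j + p + 1 + 1 - j = p + 1 + 1 := by omega
    have hZ : ∀ k : ℕ, 1 - -q ^ (2 * j) * q * q ^ k ≠ 0 := fun k => by
      have := hm (2 * j + k); rw [pow_add] at this; convert this using 2; ring
    have h := sum_wellPoised hq hZ p
    rw [a1, ← mul_zero (qPoch (-1) q (2 * j) / (2 * qPoch (-q) q j * qPoch (-q) q (2 * j))), ← h,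
      Finset.mul_sum]
    refine Finset.sum_congr rfl fun k _ => ?_
    have a2 : j + p + 1 - (j + k) = p + 1 - k := by omega
    have a3 : j + p + 1 + (j + k) = 2 * j + (p + 1 + k) := by omega
    have a4 : -q * q ^ (2 * j) = -q ^ (2 * j) * q := by ring
    have a5 : -1 * q ^ (2 * j) = -q ^ (2 * j) := by ring
    simp only [f, a2, a3, qPoch_add (-1) q (2 * j), qPoch_add (-q) q (2 * j), a4, a5]
    have := hM j; have := hM (2 * j); have := hP k; have := hP (p + 1 - k)
    have := qPoch_ne_zero hZ (p + 1 + k)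
    field_simp
    ring

/-- The finite Bailey lemma for the pair `baileyAlpha q`, `1 / (-q;q)_n`. -/
theorem sum_bailey_transform {q : ℂ} (hq : ∀ k : ℕ, 1 - q * q ^ k ≠ 0)
    (hm : ∀ k : ℕ, 1 - -q * q ^ k ≠ 0) (L : ℕ) :
    ∑ n ∈ Finset.range (L + 1), (-1) ^ n * q ^ (n ^ 2) / qPoch (-q) q n * (1 / qPoch q q (L - n)) =
    ∑ r ∈ Finset.range (L + 1), (-1) ^ r * q ^ (r ^ 2) * baileyAlpha q r *
      (1 / (qPoch q q (L - r) * qPoch (-q) q (L + r))) := by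
  have hP := qPoch_ne_zero hq
  have hM := qPoch_ne_zero hm
  let f : ℕ → ℕ → ℂ := fun r m =>
    (-1) ^ (r + m) * q ^ ((r + m) ^ 2) / qPoch q q (L - (r + m)) *
      (baileyAlpha q r / (qPoch q q m * qPoch (-q) q (r + m + r)))
  have e1 : ∀ n ∈ Finset.range (L + 1),
      (-1) ^ n * q ^ (n ^ 2) / qPoch (-q) q n * (1 / qPoch q q (L - n)) =
      ∑ r ∈ Finset.range (n + 1), f r (n - r) := by
    intro n _
    have h := sum_baileyAlpha hq hm n
    rw [show (-1) ^ n * q ^ (n ^ 2) / qPoch (-q) q n * (1 / qPoch q q (L - n)) =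
      (-1) ^ n * q ^ (n ^ 2) / qPoch q q (L - n) * (1 / qPoch (-q) q n) by ring, ← h,
      Finset.mul_sum]
    refine Finset.sum_congr rfl fun r hr => ?_
    obtain ⟨p, rfl⟩ := Nat.exists_eq_add_of_le (Nat.lt_succ_iff.1 (Finset.mem_range.1 hr))
    have a1 : r + p - r = p := by omega
    simp only [f, a1]
  rw [Finset.sum_congr rfl e1, Finset.sum_range_diag_flip]
  refine Finset.sum_congr rfl fun r hr => ?_
  obtain ⟨p, rfl⟩ := Nat.exists_eq_add_of_le (Nat.lt_succ_iff.1 (Finset.mem_range.1 hr))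
  have a1 : r + p + 1 - r = p + 1 := by omega
  have a2 : r + p - r = p := by omega
  have a3 : r + p + r = 2 * r + p := by omega
  have a4 : -q * q ^ (2 * r) = -q ^ (2 * r) * q := by ring
  have hZ : ∀ k : ℕ, 1 - -q ^ (2 * r) * q * q ^ k ≠ 0 := fun k => by
    have := hm (2 * r + k); rw [pow_add] at this; convert this using 2; ring
  have h := sum_cauchy hq p _ hZ
  have hM2 := hM (2 * r)
  have h2 : 1 / (qPoch q q p * qPoch (-q) q (2 * r + p)) =
      1 / qPoch (-q) q (2 * r) * (1 / (qPoch q q p * qPoch (-q ^ (2 * r) * q) q p)) := by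
    rw [qPoch_add, a4]
    have := hP p; have := qPoch_ne_zero hZ p
    field_simp
  rw [a1, a2, a3, h2, ← h, Finset.mul_sum, Finset.mul_sum]
  refine Finset.sum_congr rfl fun m hm => ?_
  have b1 : r + p - (r + m) = p - m := by omega
  have b2 : r + m + r = 2 * r + m := by omega
  simp only [f, b1, b2, qPoch_add (-q) q (2 * r), a4]
  have := hP m; have := hP (p - m); have := qPoch_ne_zero hZ m
  have b3 : (-q ^ (2 * r)) ^ m = (-1) ^ m * q ^ (2 * r * m) := by
    rw [neg_pow, ← pow_mul]
  rw [b3]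
  field_simp
  ring

theorem sum_inversionTerm_partial {q : ℂ} (hq : ∀ k : ℕ, 1 - q * q ^ k ≠ 0)
    (hm : ∀ k : ℕ, 1 - -q * q ^ k ≠ 0) (k : ℕ) : ∀ p : ℕ,
    ∑ i ∈ Finset.range (k + 1),
      ((1 + q ^ (k + p)) * (1 + q * q ^ (k + p)) * inversionTerm q (k + p + 1) i +
        q * (q ^ (k + p)) ^ 3 * (1 - (q ^ (k + p)) ^ 2) * inversionTerm q (k + p) i) =
    (1 + q ^ (k + p)) * ((q ^ (k + p)) ^ 2 * (1 + q * q ^ (k + p)) +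
      (1 + q * (q ^ (k + p)) ^ 2) * q ^ k) * inversionTerm q (k + p) k := by
  have hP := qPoch_ne_zero hq
  have hM := qPoch_ne_zero hm
  induction k with
  | zero =>
    intro p
    have a1 : 2 * (p + 1) = 2 * p + 1 + 1 := by omega
    simp only [zero_add, Finset.sum_range_one, inversionTerm, Nat.sub_zero, a1, qPoch_succ (-1),
      qPoch_succ (-q), qPoch_zero]
    have x1 : q ^ (2 * p + 1) = q * (q ^ p) ^ 2 := by ring
    have x2 : q ^ (2 * p) = (q ^ p) ^ 2 := by ring
    rw [x1, x2]
    have := hM p; have h := hm p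
    generalize q ^ p = x at *
    obtain ⟨u, hu⟩ : ∃ u, u = 1 - -q * x := ⟨_, rfl⟩
    rw [← hu] at h ⊢
    simp
    field_simp
    rw [hu]
    ring
  | succ k ih =>
    intro p
    rw [Finset.sum_range_succ]
    have ih := ih (p + 1)
    rw [show k + (p + 1) = k + 1 + p by omega] at ih
    rw [ih]
    have b1 : 2 * (k + 1 + p) - k = k + 1 + 2 * p + 1 := by omega
    have b2 : k + 1 + p - k = p + 1 := by omega
    have b3 : 2 * (k + 1 + p + 1) - (k + 1) = k + 1 + 2 * p + 1 + 1 := by omega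
    have b4 : k + 1 + p + 1 - (k + 1) = p + 1 := by omega
    have b5 : 2 * (k + 1 + p) - (k + 1) = k + 1 + 2 * p := by omega
    have b6 : k + 1 + p - (k + 1) = p := by omega
    have e4 : (k + 1).choose 2 = k.choose 2 + k := by
      rw [Nat.choose_succ_succ' k 1, Nat.choose_one_right, add_comm]
    simp only [inversionTerm, b1, b2, b3, b4, b5, b6, e4, qPoch_succ (-1) q (k + 1 + 2 * p + 1),
      qPoch_succ (-1) q (k + 1 + 2 * p), qPoch_succ (-q) q p, qPoch_succ q q k]
    have x1 : q ^ (k + 1 + 2 * p + 1) = q ^ 2 * q ^ k * (q ^ p) ^ 2 := by ring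
    have x2 : q ^ (k + 1 + 2 * p) = q * q ^ k * (q ^ p) ^ 2 := by ring
    have x3 : q ^ (k + 1 + p) = q * q ^ k * q ^ p := by ring
    have x4 : q ^ (k + 1) = q * q ^ k := by ring
    have x5 : q ^ (k.choose 2 + k) = q ^ (k.choose 2) * q ^ k := by ring
    rw [x1, x2, x3, x4, x5, pow_succ (-1 : ℂ) k]
    have := hM p; have := hP k; have h := hm p; have := hq k
    generalize q ^ p = w at *
    generalize q ^ k = y at *
    have h' : 1 + q * w ≠ 0 := by convert h using 1; ring
    rw [show 1 - -q * w = 1 + q * w by ring]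
    field_simp
    ring

theorem inversionSum_rec {q : ℂ} (hq : ∀ k : ℕ, 1 - q * q ^ k ≠ 0)
    (hm : ∀ k : ℕ, 1 - -q * q ^ k ≠ 0) (n : ℕ) :
    (1 + q ^ n) * (1 + q * q ^ n) * inversionSum q (n + 1) +
      q * (q ^ n) ^ 3 * (1 - (q ^ n) ^ 2) * inversionSum q n =
    (-1) ^ (n + 1) * (qPoch (-1) q (n + 1) / qPoch q q (n + 1)) * (1 + q * (q ^ n) ^ 2) *
      q ^ ((n + 2).choose 2) := by
  have hP := qPoch_ne_zero hq
  have h := sum_inversionTerm_partial hq hm n 0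
  rw [Finset.sum_add_distrib, ← Finset.mul_sum, ← Finset.mul_sum] at h
  simp only [add_zero] at h
  rw [← inversionSum] at h
  rw [inversionSum, Finset.sum_range_succ, mul_add, add_right_comm, h]
  have b1 : 2 * n - n = n := by omega
  have b2 : 2 * (n + 1) - (n + 1) = n + 1 := by omega
  have e4 : (n + 1).choose 2 = n.choose 2 + n := by
    rw [Nat.choose_succ_succ' n 1, Nat.choose_one_right, add_comm]
  have e5 : (n + 2).choose 2 = n.choose 2 + n + (n + 1) := by
    rw [Nat.choose_succ_succ' (n + 1) 1, Nat.choose_one_right, add_comm, e4]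
  simp only [inversionTerm, b1, b2, Nat.sub_self, qPoch_zero, e4, e5, qPoch_succ _ q n]
  have x5 : q ^ (n.choose 2 + n) = q ^ (n.choose 2) * q ^ n := by ring
  have x6 : q ^ (n.choose 2 + n + (n + 1)) = q ^ (n.choose 2) * q ^ n * (q * q ^ n) := by ring
  rw [x5, x6, pow_succ (-1 : ℂ) n]
  have := hP n; have := hq n
  generalize q ^ n = x at *
  obtain ⟨u, hu⟩ : ∃ u, u = 1 - q * x := ⟨_, rfl⟩
  have hu0 : u ≠ 0 := by rw [hu]; assumption
  rw [← hu]
  field_simp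
  rw [hu]
  ring

/-- The truncated binomial series `∑_{j ≤ n} (-1;q)_j / (q;q)_j (-q^{1-n})^j`. -/
noncomputable def heckeSum (q : ℂ) (n : ℕ) : ℂ :=
  ∑ j ∈ Finset.range (n + 1), qPoch (-1) q j / qPoch q q j * (-(q ^ (1 - (n : ℤ)))) ^ j

theorem truncated_qBinomial_shift {q : ℂ} (hq : ∀ k : ℕ, 1 - q * q ^ k ≠ 0) (x : ℂ) (n : ℕ) :
    (1 - x) * ∑ j ∈ Finset.range (n + 1), qPoch (-1) q j / qPoch q q j * x ^ j =
    (1 + x) * ∑ j ∈ Finset.range (n + 1), qPoch (-1) q j / qPoch q q j * (q * x) ^ j -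
      qPoch (-1) q n / qPoch q q n * (1 + q ^ n) * x ^ (n + 1) := by
  have hP := qPoch_ne_zero hq
  induction n with
  | zero => simp [qPoch_zero]; ring
  | succ n ih =>
    rw [Finset.sum_range_succ, mul_add, ih, Finset.sum_range_succ _ (n + 1), qPoch_succ, qPoch_succ]
    have := hP n; have := hq n
    rw [mul_pow, pow_succ' q n]
    field_simp
    ring

theorem heckeSum_rec {q : ℂ} (hq0 : q ≠ 0) (hq : ∀ k : ℕ, 1 - q * q ^ k ≠ 0) (n : ℕ) :
    ((1 + q ^ n) * heckeSum q (n + 1) + (1 - q ^ n) * heckeSum q n) * q ^ (n ^ 2 + n) =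
    (-1) ^ (n + 1) * (qPoch (-1) q (n + 1) / qPoch q q (n + 1)) * (1 + q * (q ^ n) ^ 2) := by
  have hP := qPoch_ne_zero hq
  have h := truncated_qBinomial_shift hq (-(q ^ n)⁻¹) n
  have e1 : heckeSum q (n + 1) =
      ∑ j ∈ Finset.range (n + 1), qPoch (-1) q j / qPoch q q j * (-(q ^ n)⁻¹) ^ j +
      qPoch (-1) q (n + 1) / qPoch q q (n + 1) * (-(q ^ n)⁻¹) ^ (n + 1) := by
    rw [heckeSum, show (1 - ((n + 1 : ℕ) : ℤ)) = -(n : ℤ) by push_cast; ring,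
      Finset.sum_range_succ, zpow_neg, zpow_natCast]
  have e2 : heckeSum q n =
      ∑ j ∈ Finset.range (n + 1), qPoch (-1) q j / qPoch q q j * (q * -(q ^ n)⁻¹) ^ j := by
    rw [heckeSum, zpow_sub₀ hq0, zpow_one, zpow_natCast, div_eq_mul_inv, mul_neg]
  rw [← e2] at h
  rw [e1]
  generalize ∑ j ∈ Finset.range (n + 1), qPoch (-1) q j / qPoch q q j * (-(q ^ n)⁻¹) ^ j = A at *
  generalize heckeSum q n = S at *
  have hx : q ^ n ≠ 0 := pow_ne_zero _ hq0
  have x1 : q ^ (n ^ 2 + n) = (q ^ n) ^ (n + 1) := by ring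
  have x2 : (-(q ^ n)⁻¹) ^ (n + 1) = (-1) ^ (n + 1) / (q ^ n) ^ (n + 1) := by
    rw [neg_pow, inv_pow, div_eq_mul_inv]
  rw [x1, x2, qPoch_succ, qPoch_succ]
  rw [x2] at h
  have := hP n; have := hq n
  have hX : (q ^ n) ^ (n + 1) ≠ 0 := pow_ne_zero _ hx
  generalize (q ^ n) ^ (n + 1) = X at *
  generalize q ^ n = x at *
  have h3 : (1 + x) * A = -(1 - x) * S -
      qPoch (-1) q n / qPoch q q n * (1 + x) * ((-1) ^ (n + 1) / X) * x := by
    have h4 := congrArg (x * ·) h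
    have h5 : x * ((1 - -x⁻¹) * A) = (1 + x) * A := by field_simp; ring
    rw [← h5, show _ = _ from h4]
    field_simp
    ring
  rw [mul_add, h3]
  obtain ⟨u, hu⟩ : ∃ u, u = 1 - q * x := ⟨_, rfl⟩
  have hu0 : u ≠ 0 := by rw [hu]; assumption
  rw [← hu]
  field_simp
  rw [hu]
  ring

theorem pentagonal_succ (n : ℕ) :
    (n + 1) * (3 * (n + 1) - 1) / 2 = n * (3 * n - 1) / 2 + (3 * n + 1) := by
  have : (n + 1) * (3 * (n + 1) - 1) = n * (3 * n - 1) + (3 * n + 1) * 2 := by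
    cases n with
    | zero => rfl
    | succ n =>
      rw [show 3 * (n + 1 + 1) - 1 = 3 * n + 5 by omega, show 3 * (n + 1) - 1 = 3 * n + 2 by omega]
      ring
  rw [this, Nat.add_mul_div_right _ _ two_pos]

theorem pentagonal_succ_eq_choose (n : ℕ) :
    (n + 1) * (3 * (n + 1) - 1) / 2 = (n + 2).choose 2 + (n ^ 2 + n) := by
  induction n with
  | zero => rfl
  | succ n ih =>
    rw [pentagonal_succ, ih, Nat.choose_succ_succ' (n + 2) 1, Nat.choose_one_right]
    ring

theorem inversionSum_eq_heckeSum {q : ℂ} (hq0 : q ≠ 0) (hq : ∀ k : ℕ, 1 - q * q ^ k ≠ 0)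
    (hm : ∀ k : ℕ, 1 - -q * q ^ k ≠ 0) (n : ℕ) :
    (1 + q ^ n) * inversionSum q n = q ^ (n * (3 * n - 1) / 2) * heckeSum q n := by
  induction n with
  | zero =>
    simp [inversionSum, inversionTerm, heckeSum, qPoch_zero]
    norm_num
  | succ n ih =>
    have h1 := inversionSum_rec hq hm n
    have h2 := heckeSum_rec hq0 hq n
    have hn : 1 + q ^ n ≠ 0 := by
      cases n with
      | zero => norm_num
      | succ n => convert hm n using 1; ring
    have e := pentagonal_succ n
    have e' := pentagonal_succ_eq_choose n
    have y1 : q ^ ((n + 1) * (3 * (n + 1) - 1) / 2) =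
        q ^ (n * (3 * n - 1) / 2) * (q * (q ^ n) ^ 3) := by rw [e]; ring
    have y2 : q ^ ((n + 1) * (3 * (n + 1) - 1) / 2) =
        q ^ ((n + 2).choose 2) * q ^ (n ^ 2 + n) := by rw [e', pow_add]
    apply mul_left_cancel₀ hn
    rw [pow_succ' q n]
    have h3 := congrArg (· * q ^ ((n + 2).choose 2)) h2
    beta_reduce at h3
    rw [← h1] at h3
    linear_combination (-1) * h3 - q * (q ^ n) ^ 3 * (1 - q ^ n) * ih
      - (1 + q ^ n) * heckeSum q (n + 1) * y2 - (1 - q ^ n) * heckeSum q n * y2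
      + (1 - q ^ n) * heckeSum q n * y1

theorem one_sub_mul_pow_ne_zero {a q : ℂ} (ha : ‖a‖ < 1) (hq : ‖q‖ < 1) (k : ℕ) :
    1 - a * q ^ k ≠ 0 := by
  intro h
  have h1 : ‖a * q ^ k‖ < 1 := by
    rw [norm_mul, norm_pow]
    exact mul_lt_one_of_nonneg_of_lt_one_left (norm_nonneg _) ha
      (pow_le_one₀ (norm_nonneg _) hq.le)
  rw [← sub_eq_zero.1 h, norm_one] at h1
  exact lt_irrefl _ h1

theorem summable_norm_neg_mul_pow (a : ℂ) {q : ℂ} (hq : ‖q‖ < 1) :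
    Summable fun k : ℕ => ‖-(a * q ^ k)‖ := by
  simpa [norm_mul, norm_pow] using
    (summable_geometric_of_lt_one (norm_nonneg q) hq).mul_left ‖a‖

theorem tendsto_qPoch (a : ℂ) {q : ℂ} (hq : ‖q‖ < 1) :
    Filter.Tendsto (qPoch a q) Filter.atTop (nhds (qPochInf a q)) := by
  have h := (multipliable_one_add_of_summable
    (summable_norm_neg_mul_pow a hq)).tendsto_prod_tprod_nat
  simp only [← sub_eq_add_neg] at h
  exact h

theorem qPochInf_ne_zero {a q : ℂ} (ha : ‖a‖ < 1) (hq : ‖q‖ < 1) : qPochInf a q ≠ 0 := by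
  have h := tprod_one_add_ne_zero_of_summable (f := fun k : ℕ => -(a * q ^ k))
    (fun k => by simpa only [← sub_eq_add_neg] using one_sub_mul_pow_ne_zero ha hq k)
    (summable_norm_neg_mul_pow a hq)
  simp only [← sub_eq_add_neg] at h
  exact h

theorem exists_norm_le_of_tendsto {u : ℕ → ℂ} {l : ℂ}
    (h : Filter.Tendsto u Filter.atTop (nhds l)) : ∃ C : ℝ, 0 ≤ C ∧ ∀ n, ‖u n‖ ≤ C := by
  obtain ⟨C, hC⟩ := (Metric.isBounded_range_of_tendsto u h).exists_norm_le
  exact ⟨C, (norm_nonneg _).trans (hC _ ⟨0, rfl⟩), fun n => hC _ ⟨n, rfl⟩⟩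

theorem exists_norm_inversionSum_le {q : ℂ} (hq : ‖q‖ < 1) :
    ∃ C : ℝ, ∀ n : ℕ, ‖inversionSum q n‖ ≤ C * (n + 1) := by
  have hq' : ‖-q‖ < 1 := by rwa [norm_neg]
  obtain ⟨A, hA0, hA⟩ := exists_norm_le_of_tendsto (tendsto_qPoch (-1) hq)
  obtain ⟨B, hB0, hB⟩ := exists_norm_le_of_tendsto
    ((tendsto_qPoch q hq).inv₀ (qPochInf_ne_zero hq hq))
  obtain ⟨D, hD0, hD⟩ := exists_norm_le_of_tendsto
    ((tendsto_qPoch (-q) hq).inv₀ (qPochInf_ne_zero hq' hq))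
  refine ⟨A * (B * D), fun n => ?_⟩
  have h : ∀ k ∈ Finset.range (n + 1), ‖inversionTerm q n k‖ ≤ A * (B * D) := by
    intro k _
    have e : inversionTerm q n k = qPoch (-1) q (2 * n - k) * ((-1) ^ k * q ^ (k.choose 2) * 2⁻¹) *
        ((qPoch q q k)⁻¹ * (qPoch (-q) q (n - k))⁻¹) := by
      simp only [inversionTerm, div_eq_mul_inv, mul_inv]; ring
    have h2 : ‖(-1 : ℂ) ^ k * q ^ (k.choose 2) * 2⁻¹‖ ≤ 1 := by
      simp only [norm_mul, norm_pow, norm_neg, norm_one, one_pow, one_mul, norm_inv,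
        Complex.norm_ofNat]
      have := pow_le_one₀ (norm_nonneg q) hq.le (n := k.choose 2)
      linarith
    have h3 := mul_le_mul (hA (2 * n - k)) h2 (norm_nonneg _) hA0
    have h4 := mul_le_mul (hB k) (hD (n - k)) (norm_nonneg _) hB0
    rw [mul_one, ← norm_mul] at h3
    rw [← norm_mul] at h4
    rw [e, norm_mul]
    exact mul_le_mul h3 h4 (norm_nonneg _) hA0
  calc ‖inversionSum q n‖ ≤ ∑ k ∈ Finset.range (n + 1), A * (B * D) :=
        norm_sum_le_of_le _ h
    _ = A * (B * D) * (n + 1) := by simp [mul_comm]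

theorem summable_norm_baileyAlpha {q : ℂ} (hq : ‖q‖ < 1) :
    Summable fun r : ℕ => ‖(-1) ^ r * q ^ (r ^ 2) * baileyAlpha q r‖ := by
  obtain ⟨C, hC⟩ := exists_norm_inversionSum_le hq
  have hr : ‖‖q‖‖ < 1 := by rwa [norm_norm]
  have hs : Summable fun r : ℕ => 2 * C * ((r : ℝ) ^ 1 * ‖q‖ ^ r + (r : ℝ) ^ 0 * ‖q‖ ^ r) :=
    ((summable_pow_mul_geometric_of_norm_lt_one 1 hr).add
      (summable_pow_mul_geometric_of_norm_lt_one 0 hr)).mul_left _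
  refine hs.of_nonneg_of_le (fun _ => norm_nonneg _) fun r => ?_
  have h1 : ‖1 + q ^ (2 * r)‖ ≤ 2 := by
    refine (norm_add_le _ _).trans ?_
    rw [norm_one, norm_pow]
    have := pow_le_one₀ (norm_nonneg q) hq.le (n := 2 * r)
    linarith
  have h2 : ‖q‖ ^ (r ^ 2) ≤ ‖q‖ ^ r :=
    pow_le_pow_of_le_one (norm_nonneg _) hq.le (Nat.le_self_pow two_ne_zero r)
  rw [baileyAlpha, norm_mul, norm_mul, norm_mul, norm_pow, norm_pow, norm_neg, norm_one, one_pow,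
    one_mul]
  calc _ ≤ ‖q‖ ^ r * (2 * (C * (r + 1))) := by
        gcongr
        exact hC r
    _ = _ := by ring

theorem summable_norm_sigma2 {q : ℂ} (hq : ‖q‖ < 1) :
    Summable fun n : ℕ => ‖(-1) ^ n * q ^ (n ^ 2) / qPoch (-q) q n‖ := by
  have hq' : ‖-q‖ < 1 := by rwa [norm_neg]
  obtain ⟨D, hD0, hD⟩ := exists_norm_le_of_tendsto
    ((tendsto_qPoch (-q) hq).inv₀ (qPochInf_ne_zero hq' hq))
  refine ((summable_geometric_of_lt_one (norm_nonneg q) hq).mul_right D).of_nonneg_of_le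
    (fun _ => norm_nonneg _) fun n => ?_
  have h2 : ‖q‖ ^ (n ^ 2) ≤ ‖q‖ ^ n :=
    pow_le_pow_of_le_one (norm_nonneg _) hq.le (Nat.le_self_pow two_ne_zero n)
  rw [div_eq_mul_inv, norm_mul, norm_mul, norm_pow, norm_pow, norm_neg, norm_one, one_pow, one_mul]
  gcongr
  exact hD n

/-- Dominated convergence for finite sums with bounded weights. -/
theorem tendsto_sum_range_mul {u : ℕ → ℂ} (hu : Summable fun n => ‖u n‖) {w : ℕ → ℕ → ℂ} {l : ℂ}
    {C : ℝ} (hw : ∀ L n, ‖w L n‖ ≤ C)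
    (hl : ∀ n, Filter.Tendsto (fun L => w L n) Filter.atTop (nhds l)) :
    Filter.Tendsto (fun L => ∑ n ∈ Finset.range (L + 1), u n * w L n) Filter.atTop
      (nhds ((∑' n, u n) * l)) := by
  have h := tendsto_tsum_of_dominated_convergence (𝓕 := Filter.atTop)
    (f := fun L n => if n ∈ Finset.range (L + 1) then u n * w L n else 0)
    (g := fun n => u n * l) (bound := fun n => ‖u n‖ * C) (hu.mul_right C) ?_ ?_
  · rw [tsum_mul_right] at h
    refine h.congr fun L => ?_
    rw [tsum_eq_sum (s := Finset.range (L + 1)) (fun n hn => if_neg hn)]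
    exact Finset.sum_congr rfl fun n hn => if_pos hn
  · intro n
    refine ((hl n).const_mul (u n)).congr' ?_
    filter_upwards [Filter.eventually_ge_atTop n] with L hL
    rw [if_pos (Finset.mem_range.2 (Nat.lt_succ_of_le hL))]
  · refine Filter.Eventually.of_forall fun L n => ?_
    split_ifs
    · rw [norm_mul]
      exact mul_le_mul_of_nonneg_left (hw L n) (norm_nonneg _)
    · rw [norm_zero]
      exact mul_nonneg (norm_nonneg _) ((norm_nonneg _).trans (hw L n))

theorem sigma2_eq_tsum_baileyAlpha {q : ℂ} (hq : ‖q‖ < 1) :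
    sigma2 q = 1 / qPochInf (-q) q * ∑' r : ℕ, (-1) ^ r * q ^ (r ^ 2) * baileyAlpha q r := by
  have hq' : ‖-q‖ < 1 := by rwa [norm_neg]
  have hP := (tendsto_qPoch q hq).inv₀ (qPochInf_ne_zero hq hq)
  have hM := (tendsto_qPoch (-q) hq).inv₀ (qPochInf_ne_zero hq' hq)
  obtain ⟨B, hB0, hB⟩ := exists_norm_le_of_tendsto hP
  obtain ⟨D, hD0, hD⟩ := exists_norm_le_of_tendsto hM
  have h1 := tendsto_sum_range_mul (summable_norm_sigma2 hq)
    (w := fun L n => 1 / qPoch q q (L - n)) (l := (qPochInf q q)⁻¹) (C := B)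
    (fun L n => by rw [one_div]; exact hB _)
    (fun n => by
      simp only [one_div]
      exact hP.comp (Filter.tendsto_sub_atTop_nat n))
  have h2 := tendsto_sum_range_mul (summable_norm_baileyAlpha hq)
    (w := fun L r => 1 / (qPoch q q (L - r) * qPoch (-q) q (L + r)))
    (l := (qPochInf q q)⁻¹ * (qPochInf (-q) q)⁻¹) (C := B * D)
    (fun L n => by
      rw [one_div, mul_inv, norm_mul]
      exact mul_le_mul (hB _) (hD _) (norm_nonneg _) hB0)
    (fun n => by
      simp only [one_div, mul_inv]
      exact (hP.comp (Filter.tendsto_sub_atTop_nat n)).mul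
        (hM.comp (Filter.tendsto_add_atTop_nat n)))
  have h3 := tendsto_nhds_unique h1 (h2.congr fun L => (sum_bailey_transform
    (one_sub_mul_pow_ne_zero hq hq) (one_sub_mul_pow_ne_zero hq' hq) L).symm)
  have h4 := qPochInf_ne_zero hq hq
  rw [← sigma2] at h3
  apply mul_right_cancel₀ (inv_ne_zero h4)
  rw [h3]
  ring

theorem sigma2_hecke_type_i (q : ℂ) (hq0 : 0 < ‖q‖) (hq1 : ‖q‖ < 1) :
    sigma2 q = (1 / qPochInf (-q) q) *
      (1 + ∑' n : ℕ,
        (-1 : ℂ) ^ (n + 1) * q ^ ((n + 1) * (5 * (n + 1) - 1) / 2) *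
          (1 + q ^ (2 * (n + 1))) / (1 + q ^ (n + 1)) *
        ∑ j ∈ Finset.range (n + 2),
          qPoch (-1) q j / qPoch q q j * (-(q ^ (1 - ((n : ℤ) + 1)))) ^ j) := by
  have hq' : ‖-q‖ < 1 := by rwa [norm_neg]
  have hm := one_sub_mul_pow_ne_zero hq' hq1
  rw [sigma2_eq_tsum_baileyAlpha hq1, (summable_norm_baileyAlpha hq1).of_norm.tsum_eq_zero_add]
  congr 2
  · simp [baileyAlpha, inversionSum, inversionTerm, qPoch_zero]
    norm_num
  · refine tsum_congr fun n => ?_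
    have h := inversionSum_eq_heckeSum (norm_pos_iff.1 hq0) (one_sub_mul_pow_ne_zero hq1 hq1) hm
      (n + 1)
    have hn : 1 + q ^ (n + 1) ≠ 0 := by convert hm n using 1; ring
    have e : (n + 1) * (5 * (n + 1) - 1) / 2 =
        (n + 1) ^ 2 + (n + 1) * (3 * (n + 1) - 1) / 2 := by
      rw [show 5 * (n + 1) - 1 = 5 * n + 4 by omega, show 3 * (n + 1) - 1 = 3 * n + 2 by omega,
        show (n + 1) * (5 * n + 4) = (n + 1) * (3 * n + 2) + (n + 1) ^ 2 * 2 by ring,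
        Nat.add_mul_div_right _ _ two_pos, add_comm]
    have hS : ∑ j ∈ Finset.range (n + 2),
        qPoch (-1) q j / qPoch q q j * (-(q ^ (1 - ((n : ℤ) + 1)))) ^ j = heckeSum q (n + 1) := by
      rw [heckeSum]
      push_cast
      rfl
    rw [hS, e, pow_add q ((n + 1) ^ 2), baileyAlpha, eq_div_of_mul_eq hn ((mul_comm _ _).trans h)]
    ring
end

section
/- For all integers m ≥ 1 and N ≥ 1, L(m,N) = R(m-1,N); that is, the number of partitions of N into exactly m parts in which the largest part, say n, occurs at least n times equals the number of Rogers–Ramanujan partitions of N with rank m−1. -/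
/-- Dyson's rank of a partition: largest part minus number of parts. -/
def partitionRank {n : ℕ} (p : Nat.Partition n) : ℤ :=
  (p.parts.sup : ℤ) - (Multiset.card p.parts : ℤ)

/-- A Rogers–Ramanujan partition: parts are distinct and any two distinct parts differ by
at least 2. -/
def IsRR {n : ℕ} (p : Nat.Partition n) : Prop :=
  p.parts.Nodup ∧ ∀ a ∈ p.parts, ∀ b ∈ p.parts, a < b → a + 2 ≤ b

/-- `R m N` is the number of Rogers–Ramanujan partitions of `N` with rank `m`. -/
noncomputable def R (m : ℤ) (N : ℕ) : ℕ :=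
  Nat.card {p : Nat.Partition N // IsRR p ∧ partitionRank p = m}

/-- `L m N` is the number of partitions of `N` into exactly `m` parts in which the largest
part, say `n`, occurs at least `n` times. -/
noncomputable def L (m N : ℕ) : ℕ :=
  Nat.card {p : Nat.Partition N //
    Multiset.card p.parts = m ∧ p.parts.sup ≤ p.parts.count p.parts.sup}

/-- Nonincreasing lists of positive integers with sum `N`. -/
def IsPartitionList (N : ℕ) (w : List ℕ) : Prop :=
  (w.SortedGE ∧ ∀ x ∈ w, 0 < x) ∧ w.sum = N

/-- Partitions of `N` correspond to nonincreasing lists of positive integers with sum `N`. -/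
def partitionEquivList (N : ℕ) : Nat.Partition N ≃ {w : List ℕ // IsPartitionList N w} where
  toFun p := ⟨p.parts.sort (· ≥ ·), ⟨(p.parts.pairwise_sort (· ≥ ·)).sortedGE,
    fun x hx => p.parts_pos ((Multiset.mem_sort _).1 hx)⟩, by
      rw [← Multiset.sum_coe, Multiset.sort_eq, p.parts_sum]⟩
  invFun w := ⟨w.1, fun hi => w.2.1.2 _ hi, w.2.2⟩
  left_inv p := by
    ext1
    exact Multiset.sort_eq _ _
  right_inv w := by
    refine Subtype.ext (List.Perm.eq_of_sortedGE
      ((w.1 : Multiset ℕ).pairwise_sort (· ≥ ·)).sortedGE w.2.1.1 ?_)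
    rw [← Multiset.coe_eq_coe, Multiset.sort_eq]

theorem card_partition_eq_card_list {N : ℕ} {P : Multiset ℕ → Prop} {Q : List ℕ → Prop}
    (h : ∀ w, IsPartitionList N w → (P w ↔ Q w)) :
    Nat.card {p : Nat.Partition N // P p.parts} =
      Nat.card {w : List ℕ // IsPartitionList N w ∧ Q w} := by
  refine Nat.card_congr (((partitionEquivList N).subtypeEquiv (q := fun w => Q w.1) ?_).trans
    (Equiv.subtypeSubtypeEquivSubtypeInter _ _))
  intro p
  rw [← h _ (partitionEquivList N p).2]
  have : ((partitionEquivList N p).1 : Multiset ℕ) = p.parts := Multiset.sort_eq _ _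
  rw [this]

theorem sup_coe_eq_headD {w : List ℕ} (hw : w.SortedGE) :
    (w : Multiset ℕ).sup = w.headD 0 := by
  cases w with
  | nil => rfl
  | cons a t =>
    apply le_antisymm
    · rw [Multiset.sup_le]
      intro b hb
      have := hw.pairwise
      simp only [Multiset.mem_coe, List.mem_cons] at hb
      rcases hb with rfl | hb
      · simp
      · exact List.rel_of_pairwise_cons this hb
    · exact Multiset.le_sup (by simp)

theorem le_count_iff_getElem {w : List ℕ} (hw : w.SortedGE) (n k : ℕ) (hn : ∀ x ∈ w, x ≤ n) :
    k ≤ w.count n ↔ ∀ i < k, w[i]? = some n := by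
  induction w generalizing k with
  | nil =>
    rcases k with _ | k
    · simp
    · simpa using ⟨0, by omega⟩
  | cons a t ih =>
    rcases k with _ | k
    · simp
    have hp := hw.pairwise
    have ih' := ih hp.tail.sortedGE k (fun x hx => hn x (List.mem_cons_of_mem _ hx))
    by_cases ha : a = n
    · subst ha
      rw [List.count_cons_self, Nat.add_le_add_iff_right, ih']
      constructor
      · intro h i hi
        rcases i with _ | i
        · rfl
        · simpa using h i (by omega)
      · intro h i hi
        simpa using h (i + 1) (by omega)
    · constructor
      · intro h
        have : n ∈ a :: t := List.count_pos_iff.1 (by omega)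
        have h1 : n ∈ t := by
          rcases List.mem_cons.1 this with h | h
          · exact absurd h.symm ha
          · exact h
        have h2 : n ≤ a := List.rel_of_pairwise_cons hp h1
        exact absurd (le_antisymm (hn a (by simp)) h2) ha
      · intro h
        have := h 0 (by omega)
        simp at this
        exact absurd this ha

namespace YoungDiagram

theorem sum_rowLens (μ : YoungDiagram) : μ.rowLens.sum = μ.card := by
  have h : ∀ c ∈ μ.cells, c.1 ∈ Finset.range (μ.colLen 0) := fun c hc => by
    rw [Finset.mem_range, ← mem_iff_lt_colLen]
    exact μ.up_left_mem le_rfl (Nat.zero_le _) hc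
  rw [YoungDiagram.card, Finset.card_eq_sum_card_fiberwise h]
  have : ∀ i, (μ.cells.filter fun c => c.1 = i).card = μ.rowLen i := fun i =>
    (μ.rowLen_eq_card).symm
  simp only [this]
  rfl

theorem card_transpose (μ : YoungDiagram) : μ.transpose.card = μ.card := by
  simp [YoungDiagram.card, transpose]

theorem headD_rowLens (μ : YoungDiagram) : μ.rowLens.headD 0 = μ.rowLen 0 := by
  rcases Nat.eq_zero_or_pos (μ.colLen 0) with h | h
  · have h1 : μ.rowLens = [] := by rw [← List.length_eq_zero_iff, length_rowLens, h]
    have h2 : ¬ 0 < μ.rowLen 0 := by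
      rw [← mem_iff_lt_rowLen, mem_iff_lt_colLen]
      omega
    rw [h1, List.headD_nil]
    omega
  · have h1 : 0 < μ.rowLens.length := by rwa [length_rowLens]
    rw [List.headD_eq_head?_getD, List.head?_eq_getElem?, List.getElem?_eq_getElem h1,
      get_rowLens, Option.getD_some]

theorem isPartitionList_rowLens (μ : YoungDiagram) : IsPartitionList μ.card μ.rowLens :=
  ⟨⟨μ.rowLens_sorted, μ.pos_of_mem_rowLens⟩, μ.sum_rowLens⟩

end YoungDiagram

open YoungDiagram in
theorem card_list_eq_card_youngDiagram {N : ℕ} {Q : List ℕ → Prop} {S : YoungDiagram → Prop}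
    (h : ∀ μ : YoungDiagram, Q μ.rowLens ↔ S μ) :
    Nat.card {w : List ℕ // IsPartitionList N w ∧ Q w} =
      Nat.card {μ : YoungDiagram // μ.card = N ∧ S μ} := by
  refine Nat.card_congr ⟨fun w => ⟨ofRowLens w.1 w.2.1.1.1, ?_⟩, fun μ => ⟨μ.1.rowLens, ?_⟩,
    fun w => Subtype.ext (rowLens_ofRowLens_eq_self (hw := w.2.1.1.1) w.2.1.1.2),
    fun μ => Subtype.ext ofRowLens_to_rowLens_eq_self⟩
  · rw [← h, ← sum_rowLens, rowLens_ofRowLens_eq_self w.2.1.1.2]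
    exact ⟨w.2.1.2, w.2.2⟩
  · refine ⟨?_, (h _).2 μ.2.2⟩
    have := μ.1.isPartitionList_rowLens
    rwa [μ.2.1] at this

/-- Transposing the Young diagram turns the condition that the largest part `n` occurs at least
`n` times into the condition that every part is at least the number of parts. -/
theorem card_le_count_eq_card_length_le (m N : ℕ) :
    Nat.card {w : List ℕ // IsPartitionList N w ∧
      (w.length = m ∧ w.headD 0 ≤ w.count (w.headD 0))} =
    Nat.card {w : List ℕ // IsPartitionList N w ∧ (w.headD 0 = m ∧ ∀ x ∈ w, w.length ≤ x)} := by
  rw [card_list_eq_card_youngDiagram (S := fun μ => μ.colLen 0 = m ∧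
      ∀ j < μ.rowLen 0, μ.rowLen 0 ≤ μ.colLen j),
    card_list_eq_card_youngDiagram (S := fun μ => μ.rowLen 0 = m ∧
      ∀ i < μ.colLen 0, μ.colLen 0 ≤ μ.rowLen i)]
  · refine Nat.card_congr (YoungDiagram.transposeOrderIso.toEquiv.subtypeEquiv fun μ => ?_)
    have : YoungDiagram.transposeOrderIso.toEquiv μ = μ.transpose := rfl
    simp [this, YoungDiagram.card_transpose]
  · intro μ
    rw [YoungDiagram.headD_rowLens, YoungDiagram.length_rowLens]
    simp [YoungDiagram.rowLens]
  · intro μ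
    rw [YoungDiagram.headD_rowLens, YoungDiagram.length_rowLens]
    refine and_congr_right fun _ => ?_
    rw [le_count_iff_getElem μ.rowLens_sorted]
    · have key : ∀ i, μ.rowLens[i]? = some (μ.rowLen 0) ↔
          i < μ.colLen 0 ∧ μ.rowLen i = μ.rowLen 0 := by
        intro i
        rw [List.getElem?_eq_some_iff]
        simp
      simp only [key]
      constructor
      · intro h j hj
        by_contra! hlt
        have h1 := (h _ hlt).2
        rw [← h1, ← YoungDiagram.mem_iff_lt_rowLen, YoungDiagram.mem_iff_lt_colLen] at hj
        exact lt_irrefl _ hj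
      · intro h i hi
        have h1 : ∀ j < μ.rowLen 0, j < μ.rowLen i := fun j hj => by
          rw [← YoungDiagram.mem_iff_lt_rowLen, YoungDiagram.mem_iff_lt_colLen]
          exact hi.trans_le (h j hj)
        refine ⟨hi.trans_le (h 0 (by omega)), ?_⟩
        refine le_antisymm (μ.rowLen_anti _ _ (Nat.zero_le _)) ?_
        by_contra! hlt
        exact lt_irrefl _ (h1 _ hlt)
    · intro x hx
      obtain ⟨i, -, rfl⟩ := List.mem_map.1 hx
      exact μ.rowLen_anti _ _ (Nat.zero_le _)

theorem sum_eq_sum_getD (w : List ℕ) : w.sum = ∑ i ∈ Finset.range w.length, w.getD i 0 := by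
  rw [Finset.sum_range, ← Fin.sum_univ_getElem]
  simp

theorem sum_eq_of_shift {w v : List ℕ} (hl : w.length = v.length)
    (h : ∀ i (hw : i < w.length) (hv : i < v.length), v[i] + 2 * i = w[i] + (w.length - 1)) :
    v.sum = w.sum := by
  have h1 : ∑ i ∈ Finset.range w.length, (v.getD i 0 + 2 * i) =
      ∑ i ∈ Finset.range w.length, (w.getD i 0 + (w.length - 1)) := by
    refine Finset.sum_congr rfl fun i hi => ?_
    have hi := Finset.mem_range.1 hi
    rw [List.getD_eq_getElem _ _ hi, List.getD_eq_getElem _ _ (hl ▸ hi), h i hi (hl ▸ hi)]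
  rw [Finset.sum_add_distrib, Finset.sum_add_distrib, ← Finset.mul_sum, mul_comm 2,
    Finset.sum_range_id_mul_two, Finset.sum_const, Finset.card_range, smul_eq_mul] at h1
  rw [sum_eq_sum_getD v, sum_eq_sum_getD w, ← hl]
  omega

theorem add_two_mul_le_getElem {v : List ℕ} (hv : v.Pairwise (fun a b => b + 2 ≤ a))
    (hpos : ∀ x ∈ v, 0 < x) (i : ℕ) (hi : i < v.length) :
    2 * (v.length - i) ≤ v[i] + 1 := by
  induction v generalizing i with
  | nil => simp at hi
  | cons a t ih =>
    have ih' := ih hv.tail (fun x hx => hpos x (List.mem_cons_of_mem _ hx))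
    rcases i with _ | i
    · have ha := hpos a (by simp)
      rcases t with _ | ⟨b, t⟩
      · simp; omega
      · have h1 := ih' 0 (by simp)
        have h2 : b + 2 ≤ a := List.rel_of_pairwise_cons hv (by simp)
        simp at h1 ⊢
        omega
    · have := ih' i (by simpa using hi)
      simpa using this

/-- Adding `w.length - 1 - 2 * i` to the part of index `i` turns partitions all of whose parts are
at least the number of parts into Rogers–Ramanujan partitions. -/
theorem card_length_le_eq_card_pairwise (m N : ℕ) (hN : 1 ≤ N) :
    Nat.card {w : List ℕ // IsPartitionList N w ∧ (w.headD 0 = m ∧ ∀ x ∈ w, w.length ≤ x)} =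
    Nat.card {w : List ℕ // IsPartitionList N w ∧
      (w.Pairwise (fun a b => b + 2 ≤ a) ∧ (w.headD 0 : ℤ) - w.length = m - 1)} := by
  refine Nat.card_congr ⟨
    fun w => ⟨w.1.mapIdx fun i x => x + (w.1.length - 1) - 2 * i, ?_⟩,
    fun v => ⟨v.1.mapIdx fun i x => x + 2 * i - (v.1.length - 1), ?_⟩, ?_, ?_⟩
  · obtain ⟨w, ⟨⟨hs, hpos⟩, hsum⟩, hhead, hlen⟩ := w
    simp only
    set v := w.mapIdx fun i x => x + (w.length - 1) - 2 * i with hv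
    have hl : w.length = v.length := by simp [hv]
    have hget : ∀ i (hw : i < w.length) (hv : i < v.length),
        v[i] + 2 * i = w[i] + (w.length - 1) := by
      intro i hi hi'
      have := hlen _ (List.getElem_mem hi)
      simp only [hv, List.getElem_mapIdx]
      omega
    have hp : v.Pairwise (fun a b => b + 2 ≤ a) := by
      rw [List.pairwise_iff_getElem]
      intro i j hi hj hij
      have h1 := hget i (by omega) hi
      have h2 := hget j (by omega) hj
      have h3 := List.pairwise_iff_getElem.1 hs.pairwise i j (by omega) (by omega) hij
      omega
    refine ⟨⟨⟨(hp.imp fun h => by omega).sortedGE, ?_⟩, ?_⟩, hp, ?_⟩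
    · intro x hx
      obtain ⟨i, hi, rfl⟩ := List.getElem_of_mem hx
      have h1 := hget i (by omega) hi
      have h2 := hlen _ (List.getElem_mem (hl ▸ hi : i < w.length))
      omega
    · rw [sum_eq_of_shift hl hget, hsum]
    · have h0 : 0 < w.length := by
        rcases w with _ | ⟨a, t⟩
        · simp at hsum; omega
        · simp
      have h1 := hget 0 h0 (hl ▸ h0)
      rw [List.headD_eq_head?_getD, List.head?_eq_getElem?, List.getElem?_eq_getElem] at hhead ⊢
      · simp only [Option.getD_some] at hhead ⊢
        omega
      · exact hl ▸ h0
      · exact h0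
  · obtain ⟨v, ⟨⟨hs, hpos⟩, hsum⟩, hp, hhead⟩ := v
    simp only
    set w := v.mapIdx fun i x => x + 2 * i - (v.length - 1) with hw
    have hl : w.length = v.length := by simp [hw]
    have hget : ∀ i (hw : i < w.length) (hv : i < v.length),
        v[i] + 2 * i = w[i] + (w.length - 1) := by
      intro i hi hi'
      have := add_two_mul_le_getElem hp hpos i hi'
      simp only [hw, List.getElem_mapIdx, List.length_mapIdx]
      omega
    have hge : ∀ x ∈ w, w.length ≤ x := by
      intro x hx
      obtain ⟨i, hi, rfl⟩ := List.getElem_of_mem hx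
      have h1 := hget i hi (by omega)
      have := add_two_mul_le_getElem hp hpos i (by omega)
      omega
    refine ⟨⟨⟨List.Pairwise.sortedGE ?_, ?_⟩, ?_⟩, ?_, hge⟩
    · rw [List.pairwise_iff_getElem]
      intro i j hi hj hij
      have h1 := hget i hi (by omega)
      have h2 := hget j hj (by omega)
      have h3 : ∀ d (h : i + d < v.length), v[i + d] + 2 * d ≤ v[i] := by
        intro d
        induction d with
        | zero => simp
        | succ d ih =>
          intro h
          have h4 := ih (by omega)
          have h5 := List.pairwise_iff_getElem.1 hp (i + d) (i + (d + 1)) (by omega) h (by omega)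
          omega
      have h4 := h3 (j - i) (by omega)
      simp only [show i + (j - i) = j by omega] at h4
      omega
    · intro x hx
      exact (List.length_pos_of_mem hx).trans_le (hge x hx)
    · rw [← sum_eq_of_shift hl hget, hsum]
    · have h0 : 0 < v.length := by
        rcases v with _ | ⟨a, t⟩
        · simp at hsum; omega
        · simp
      have h1 := hget 0 (hl ▸ h0) h0
      rw [List.headD_eq_head?_getD, List.head?_eq_getElem?, List.getElem?_eq_getElem] at hhead ⊢
      · simp only [Option.getD_some] at hhead ⊢
        omega
      · exact hl ▸ h0
      · exact h0
  · rintro ⟨w, ⟨⟨hs, hpos⟩, hsum⟩, hhead, hlen⟩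
    apply Subtype.ext
    refine List.ext_getElem (by simp) fun i h1 h2 => ?_
    replace h2 : i < w.length := h2
    have := hlen _ (List.getElem_mem h2)
    simp only [List.getElem_mapIdx, List.length_mapIdx]
    omega
  · rintro ⟨v, ⟨⟨hs, hpos⟩, hsum⟩, hp, hhead⟩
    apply Subtype.ext
    refine List.ext_getElem (by simp) fun i h1 h2 => ?_
    replace h2 : i < v.length := h2
    have := add_two_mul_le_getElem hp hpos i h2
    simp only [List.getElem_mapIdx, List.length_mapIdx]
    omega

theorem nodup_and_gap_iff_pairwise {w : List ℕ} (hw : w.SortedGE) :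
    ((w : Multiset ℕ).Nodup ∧ ∀ a ∈ (w : Multiset ℕ), ∀ b ∈ (w : Multiset ℕ), a < b → a + 2 ≤ b) ↔
      w.Pairwise (fun a b => b + 2 ≤ a) := by
  simp only [Multiset.coe_nodup, Multiset.mem_coe]
  constructor
  · rintro ⟨hn, h⟩
    refine (hw.sortedGT_of_nodup hn).pairwise.imp_of_mem fun ha hb hab => h _ hb _ ha hab
  · intro h
    refine ⟨h.imp fun h => by omega, ?_⟩
    intro a ha b hb hab
    obtain ⟨i, hi, rfl⟩ := List.getElem_of_mem ha
    obtain ⟨j, hj, rfl⟩ := List.getElem_of_mem hb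
    rw [List.pairwise_iff_getElem] at h
    rcases lt_trichotomy i j with hij | rfl | hij
    · have := h i j hi hj hij
      omega
    · omega
    · exact h j i hj hi hij

theorem L_eq_R (m N : ℕ) (hm : 1 ≤ m) (hN : 1 ≤ N) :
    L m N = R ((m : ℤ) - 1) N := by
  rw [L, R, card_partition_eq_card_list
    (P := fun s => Multiset.card s = m ∧ s.sup ≤ s.count s.sup)
    (Q := fun w => w.length = m ∧ w.headD 0 ≤ w.count (w.headD 0)),
    card_le_count_eq_card_length_le, card_length_le_eq_card_pairwise m N hN]
  · refine (card_partition_eq_card_list (P := fun s =>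
      (s.Nodup ∧ ∀ a ∈ s, ∀ b ∈ s, a < b → a + 2 ≤ b) ∧
        (s.sup : ℤ) - (Multiset.card s : ℤ) = (m : ℤ) - 1) fun w hw => ?_).symm
    rw [nodup_and_gap_iff_pairwise hw.1.1, sup_coe_eq_headD hw.1.1, Multiset.coe_card]
  · intro w hw
    rw [sup_coe_eq_headD hw.1.1, Multiset.coe_card, Multiset.coe_count]
end
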